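/- arXiv:1207.6460 — 3 statements merged into one kernel-verified Lean document; each statement's English description precedes it below -/
import Mathlib

section
/- Let d ∈ ℕ be squarefree, k = ℚ(i√d), E a quaternion algebra over ℚ, M = k ⊗_ℚ E, and T ∈ M^× with Φ_E(T) = T*. Then F(E,T) := {A ∈ M | T·Φ_E(A)·T⁻¹ = A} is a quaternion algebra over ℚ, N(T) ∈ ℚ^×, and for every place p of ℚ one has the Hilbert symbol identity (N(T), −d)_p = (E/p)·(F(E,T)/p), where (F/p) is +1 if F splits at p and −1 if F ramifies at p. -/
open scoped Quaternion Classical Polynomial TensorProduct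

/-- The Hilbert equation `a x² + b y² = 1` has a solution over `R`.
For nonzero rationals `a`, `b` and `R` a completion of `ℚ` this says that the
Hilbert symbol `(a,b)` is `+1`, equivalently that the quaternion algebra
`ℍ[R,a,b]` splits. -/
def HilbertOne (R : Type*) [CommRing R] [Algebra ℚ R] (a b : ℚ) : Prop :=
  ∃ x y : R, (algebraMap ℚ R a) * x ^ 2 + (algebraMap ℚ R b) * y ^ 2 = 1

/-- Places of `ℚ`: the primes together with the infinite place. -/
inductive QPlace : Type
  | fin : (p : ℕ) → p.Prime → QPlace
  | inf : QPlace

/-- The Hilbert equation has a solution in the completion of `ℚ` at the place `v`. -/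
def QPlace.Hone : QPlace → ℚ → ℚ → Prop
  | .fin p hp, a, b => letI : Fact p.Prime := ⟨hp⟩; HilbertOne ℚ_[p] a b
  | .inf, a, b => HilbertOne ℝ a b

/-- The Hilbert symbol `(a,b)_v ∈ {±1}` at a place `v` of `ℚ`. -/
noncomputable def QPlace.sym (v : QPlace) (a b : ℚ) : ℤ :=
  if v.Hone a b then 1 else -1

/-- A prime `p` splits in `k = ℚ(√-d)` iff `-d` is a square in `ℚ_p`. -/
def SplitsInK (d : ℕ) (p : ℕ) (hp : p.Prime) : Prop :=
  letI : Fact p.Prime := ⟨hp⟩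
  ∃ x : ℚ_[p], x ^ 2 = (-(d : ℚ_[p]))

/-- A place of `ℚ` splits in `k = ℚ(√-d)` (the infinite place never splits). -/
def QPlace.SplitsK (v : QPlace) (d : ℕ) : Prop :=
  match v with
  | .fin p hp => SplitsInK d p hp
  | .inf => False

/-- `Σ_k(F)` for `F = ℍ[ℚ,a,b]` and `k = ℚ(√-d)`: a squarefree natural number whose
prime divisors are exactly the finite ramification primes of `F` that split in `k`. -/
def IsSigmaK (d : ℕ) (a b : ℚ) (sk : ℕ) : Prop :=
  Squarefree sk ∧ ∀ (p : ℕ) (hp : p.Prime),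
    (p ∣ sk ↔ (¬ (letI : Fact p.Prime := ⟨hp⟩; HilbertOne ℚ_[p] a b) ∧ SplitsInK d p hp))

/-- `Σ(F)` for `F = ℍ[ℚ,a,b]`: the signed squarefree integer whose prime divisors are the
finite ramification primes of `F`, and which is negative iff `F` ramifies at `∞`. -/
def IsSigma (a b : ℚ) (sf : ℤ) : Prop :=
  Squarefree sf ∧
    (∀ (p : ℕ) (hp : p.Prime),
      ((p : ℤ) ∣ sf ↔ ¬ (letI : Fact p.Prime := ⟨hp⟩; HilbertOne ℚ_[p] a b))) ∧
    (sf < 0 ↔ ¬ HilbertOne ℝ a b)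

/-- The field `k = ℚ(i√d)`, realized as `ℚ[X]/(X² + d)`. -/
noncomputable abbrev Qk (d : ℕ) : Type :=
  AdjoinRoot ((Polynomial.X : ℚ[X]) ^ 2 + Polynomial.C (d : ℚ))

/-- The element `i√d` of `k`. -/
noncomputable def QkRoot (d : ℕ) : Qk d := AdjoinRoot.root _


/-- `M = k ⊗_ℚ E` for `E = ℍ[ℚ,a,b]`, realized as the quaternion algebra `ℍ[k,a,b]`
over `k = ℚ(i√d)`. -/
noncomputable abbrev Mq (d : ℕ) (a b : ℚ) : Type :=
  ℍ[Qk d, algebraMap ℚ (Qk d) a, algebraMap ℚ (Qk d) b]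

/-- The elements of `M = ℍ[k,a,b]` lying in `E = ℍ[ℚ,a,b]`, i.e. the quaternions all of
whose coordinates are rational. -/
def IsRatQuat (d : ℕ) (a b : ℚ) (A : Mq d a b) : Prop :=
  ∃ w x y z : ℚ,
    A = (⟨algebraMap ℚ (Qk d) w, algebraMap ℚ (Qk d) x,
          algebraMap ℚ (Qk d) y, algebraMap ℚ (Qk d) z⟩ : Mq d a b)

/-- `F(E,T) = {A ∈ M | T Φ(A) T⁻¹ = A}` as a `ℚ`-subalgebra of `M`. -/
def FET {M : Type*} [Ring M] [Algebra ℚ M] (Φ : M ≃ₐ[ℚ] M) (T : Mˣ) : Subalgebra ℚ M where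
  carrier := {A | (T : M) * Φ A * (↑T⁻¹ : M) = A}
  mul_mem' := by
    intro x y hx hy
    have h1 : (↑T⁻¹ : M) * x * T = Φ x := by
      conv_lhs => rw [← hx]
      simp [mul_assoc]
    have h2 : (↑T⁻¹ : M) * y * T = Φ y := by
      conv_lhs => rw [← hy]
      simp [mul_assoc]
    show (T : M) * Φ (x * y) * (↑T⁻¹ : M) = x * y
    rw [map_mul, ← h1, ← h2]
    simp [mul_assoc]
  add_mem' := by
    intro x y hx hy
    show (T : M) * Φ (x + y) * (↑T⁻¹ : M) = x + y
    rw [map_add, mul_add, add_mul]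
    exact congrArg₂ (· + ·) hx hy
  algebraMap_mem' := by
    intro r
    show (T : M) * Φ (algebraMap ℚ M r) * (↑T⁻¹ : M) = algebraMap ℚ M r
    rw [AlgEquiv.commutes, ← Algebra.commutes r (T : M), mul_assoc, Units.mul_inv, mul_one]

/-- `z` is a value of the binary quadratic form `X² - βY²`. -/
def IsBinaryNorm {K : Type*} [CommRing K] (β z : K) : Prop :=
  ∃ x y : K, z = x ^ 2 - β * y ^ 2

/-- For every `β ≠ 0`, the nonzero values of `X² - βY²` form a subgroup of `Kˣ` of index
at most two. -/
def BinaryNormIndexLETwo (K : Type*) [CommRing K] : Prop :=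
  ∀ β : K, β ≠ 0 → ∃ r : K, r ≠ 0 ∧ ∀ z : K, z ≠ 0 → IsBinaryNorm β z ∨ IsBinaryNorm β (z * r)

section BinaryNorm

variable {K : Type*} [Field K] {β β' z w s : K}

lemma IsBinaryNorm.mul (hz : IsBinaryNorm β z) (hw : IsBinaryNorm β w) :
    IsBinaryNorm β (z * w) := by
  obtain ⟨x, y, rfl⟩ := hz
  obtain ⟨u, v, rfl⟩ := hw
  exact ⟨x * u + β * y * v, x * v + y * u, by ring⟩

lemma isBinaryNorm_sq (β s : K) : IsBinaryNorm β (s ^ 2) := ⟨s, 0, by ring⟩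

lemma isBinaryNorm_neg_self (β : K) : IsBinaryNorm β (-β) := ⟨0, 1, by ring⟩

lemma IsBinaryNorm.of_mul_sq (hs : s ≠ 0) (h : IsBinaryNorm β (z * s ^ 2)) :
    IsBinaryNorm β z := by
  have := h.mul (isBinaryNorm_sq β s⁻¹)
  rwa [mul_assoc, ← mul_pow, mul_inv_cancel₀ hs, one_pow, mul_one] at this

lemma IsBinaryNorm.of_mul_right (hw : w ≠ 0) (h : IsBinaryNorm β (z * w))
    (h' : IsBinaryNorm β w) : IsBinaryNorm β z :=
  .of_mul_sq hw (by simpa [sq, mul_assoc] using h.mul h')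

lemma IsBinaryNorm.of_mul_eq_sq (hw : w ≠ 0) (h : IsBinaryNorm β w) (e : z * w = s ^ 2) :
    IsBinaryNorm β z :=
  .of_mul_right hw (e ▸ isBinaryNorm_sq β s) h

lemma IsBinaryNorm.congr_left (hβ' : β' ≠ 0) (e : β * β' = s ^ 2)
    (h : IsBinaryNorm β z) : IsBinaryNorm β' z := by
  obtain ⟨x, y, rfl⟩ := h
  refine ⟨x, s / β' * y, ?_⟩
  have : β = β' * (s / β') ^ 2 := by field_simp; exact e
  rw [this]; ring

/-- A quadratic form `X² - s²Y²` is universal. -/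
lemma isBinaryNorm_sq_left (h2 : (2 : K) ≠ 0) (hs : s ≠ 0) (z : K) :
    IsBinaryNorm (s ^ 2) z :=
  ⟨(z + 1) / 2, (z - 1) / (2 * s), by field_simp; ring⟩

/-- Solvability of `βX² + zY² = 1` in terms of values of `X² - βY²`. -/
lemma exists_mul_sq_add_mul_sq_eq_one_iff (h2 : (2 : K) ≠ 0) (hβ : β ≠ 0) (hz : z ≠ 0) :
    (∃ x y : K, β * x ^ 2 + z * y ^ 2 = 1) ↔ IsBinaryNorm β z := by
  constructor
  · rintro ⟨x, y, h⟩
    by_cases hy : y = 0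
    · have hx : x ≠ 0 := by rintro rfl; simp [hy] at h
      have : β = (x⁻¹) ^ 2 := by
        field_simp; simpa [hy] using h
      rw [this]
      exact isBinaryNorm_sq_left h2 (inv_ne_zero hx) z
    · exact ⟨1 / y, x / y, by field_simp; linear_combination h⟩
  · rintro ⟨u, v, h⟩
    by_cases hu : u = 0
    · subst hu
      have hv : v ≠ 0 := by rintro rfl; simp at h; exact hz h
      refine ⟨(1 + 1 / β) / 2, (1 - 1 / β) / (2 * v), ?_⟩
      rw [h]; field_simp; ring
    · exact ⟨v / u, 1 / u, by field_simp; linear_combination h⟩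

lemma isBinaryNorm_comm (h2 : (2 : K) ≠ 0) (hβ : β ≠ 0) (hz : z ≠ 0) :
    IsBinaryNorm β z ↔ IsBinaryNorm z β := by
  rw [← exists_mul_sq_add_mul_sq_eq_one_iff h2 hβ hz,
    ← exists_mul_sq_add_mul_sq_eq_one_iff h2 hz hβ, exists_comm]
  simp only [add_comm]

lemma BinaryNormIndexLETwo.isBinaryNorm_mul (hK : BinaryNormIndexLETwo K) (hβ : β ≠ 0)
    (hz : z ≠ 0) (hw : w ≠ 0) (h : ¬ IsBinaryNorm β z) (h' : ¬ IsBinaryNorm β w) :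
    IsBinaryNorm β (z * w) := by
  obtain ⟨r, hr, H⟩ := hK β hβ
  refine .of_mul_sq hr ?_
  have := ((H z hz).resolve_left h).mul ((H w hw).resolve_left h')
  rwa [show z * w * r ^ 2 = z * r * (w * r) by ring]

lemma binaryNormIndexLETwo_real : BinaryNormIndexLETwo ℝ := by
  intro β hβ
  refine ⟨-1, by norm_num, fun z hz ↦ ?_⟩
  rcases lt_or_gt_of_ne hz with h | h
  · exact .inr ⟨√(-z), 0, by rw [Real.sq_sqrt (by linarith)]; ring⟩
  · exact .inl ⟨√z, 0, by rw [Real.sq_sqrt h.le]; ring⟩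

end BinaryNorm

section Padic

variable {p : ℕ} [Fact p.Prime]

lemma PadicInt.isSquare_of_norm_sub_sq_lt {w a : ℤ_[p]} (h : ‖w - a ^ 2‖ < ‖2 * a‖ ^ 2) :
    IsSquare w := by
  have := hensels_lemma (p := p) (R := ℤ_[p]) (F := Polynomial.X ^ 2 - Polynomial.C w) (a := a)
    (by simpa [norm_sub_rev, one_add_one_eq_two] using h)
  obtain ⟨z, hz, -⟩ := this
  exact ⟨z, by simp at hz; linear_combination -hz⟩

lemma PadicInt.toZMod_eq_zero_iff {w : ℤ_[p]} : PadicInt.toZMod w = 0 ↔ ‖w‖ < 1 := by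
  rw [← RingHom.mem_ker, PadicInt.ker_toZMod, IsLocalRing.mem_maximalIdeal, PadicInt.mem_nonunits]

lemma PadicInt.isSquare_of_isSquare_toZMod (hp : p ≠ 2) {w : ℤ_[p]}
    (hw : PadicInt.toZMod w ≠ 0) (h : IsSquare (PadicInt.toZMod w)) : IsSquare w := by
  obtain ⟨b, hb⟩ := h
  obtain ⟨a, rfl⟩ := ZMod.ringHom_surjective (PadicInt.toZMod (p := p)) b
  have h2a : ‖2 * a‖ = 1 := by
    refine le_antisymm (PadicInt.norm_le_one _) (not_lt.1 fun hlt ↦ ?_)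
    rw [← PadicInt.toZMod_eq_zero_iff, map_mul, mul_eq_zero] at hlt
    rcases hlt with h2 | h0
    · have : (p : ℕ) ∣ 2 := by
        rw [← ZMod.natCast_eq_zero_iff]; simpa only [map_ofNat, Nat.cast_ofNat] using h2
      exact hp ((Nat.prime_dvd_prime_iff_eq Fact.out Nat.prime_two).1 this)
    · simp [h0] at hb; exact hw hb
  refine PadicInt.isSquare_of_norm_sub_sq_lt (a := a) ?_
  rw [h2a, one_pow, ← PadicInt.toZMod_eq_zero_iff]
  simp [hb, sq]

lemma PadicInt.toZMod_units_ne_zero (u : ℤ_[p]ˣ) : PadicInt.toZMod (u : ℤ_[p]) ≠ 0 :=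
  (u.map (PadicInt.toZMod : ℤ_[p] →+* ZMod p).toMonoidHom).ne_zero

/-- Every nonzero `p`-adic number is a unit or `p` times a unit, up to squares. -/
lemma Padic.exists_unit_mul_sq {z : ℚ_[p]} (hz : z ≠ 0) :
    ∃ (u : ℤ_[p]ˣ) (s : ℚ_[p]), s ≠ 0 ∧
      (z = (u : ℤ_[p]) * s ^ 2 ∨ z = p * (u : ℤ_[p]) * s ^ 2) := by
  have hp0 : (p : ℚ_[p]) ≠ 0 := Nat.cast_ne_zero.2 (Fact.out : p.Prime).ne_zero
  have hn : ‖z * (p : ℚ_[p]) ^ (-z.valuation)‖ = 1 := by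
    rw [norm_mul, Padic.norm_eq_zpow_neg_valuation hz, Padic.norm_p_zpow,
      ← zpow_add₀ (by exact_mod_cast (Fact.out : p.Prime).ne_zero)]
    simp
  have e : z = (PadicInt.mkUnits hn : ℤ_[p]) * (p : ℚ_[p]) ^ z.valuation := by
    rw [PadicInt.mkUnits_eq, mul_assoc, ← zpow_add₀ hp0]; simp
  obtain ⟨k, hk⟩ := Int.even_or_odd' z.valuation
  refine ⟨PadicInt.mkUnits hn, (p : ℚ_[p]) ^ k, zpow_ne_zero _ hp0, ?_⟩
  generalize PadicInt.mkUnits hn = u at e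
  have hsq : ((p : ℚ_[p]) ^ k) ^ 2 = (p : ℚ_[p]) ^ (2 * k) := by
    rw [← zpow_natCast, ← zpow_mul, mul_comm k]; rfl
  rw [hsq]
  refine hk.imp (fun h ↦ by rwa [h] at e) fun h ↦ ?_
  rw [h, zpow_add₀ hp0, zpow_one] at e
  rw [mul_comm (p : ℚ_[p]), mul_assoc, mul_comm (p : ℚ_[p])]; exact e

/-- For odd `p`, the norm form of an unramified quadratic extension represents every unit. -/
lemma Padic.isBinaryNorm_units (hp : p ≠ 2) (u v : ℤ_[p]ˣ) :
    IsBinaryNorm ((u : ℤ_[p]) : ℚ_[p]) ((v : ℤ_[p]) : ℚ_[p]) := by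
  suffices IsBinaryNorm (u : ℤ_[p]) (v : ℤ_[p]) by
    obtain ⟨x, y, h⟩ := this
    exact ⟨x, y, by rw [h]; push_cast; rfl⟩
  have hu := PadicInt.toZMod_units_ne_zero u
  have hv := PadicInt.toZMod_units_ne_zero v
  have hodd : Fintype.card (ZMod p) % 2 = 1 := by
    rw [ZMod.card]; exact ((Fact.out : p.Prime).eq_two_or_odd).resolve_left hp
  obtain ⟨x, y, h⟩ := FiniteField.exists_root_sum_quadratic (R := ZMod p)
    (f := Polynomial.X ^ 2 - Polynomial.C (PadicInt.toZMod (v : ℤ_[p])))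
    (g := Polynomial.C (-PadicInt.toZMod (u : ℤ_[p])) * Polynomial.X ^ 2)
    (Polynomial.degree_X_pow_sub_C (by decide) _)
    (by rw [Polynomial.degree_C_mul_X_pow 2 (neg_ne_zero.2 hu)]; rfl) hodd
  obtain ⟨x, rfl⟩ := ZMod.ringHom_surjective (PadicInt.toZMod (p := p)) x
  obtain ⟨y, rfl⟩ := ZMod.ringHom_surjective (PadicInt.toZMod (p := p)) y
  simp only [Polynomial.eval_sub, Polynomial.eval_pow, Polynomial.eval_X, Polynomial.eval_C,
    Polynomial.eval_mul] at h
  by_cases hx : PadicInt.toZMod x = 0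
  · have hu' : PadicInt.toZMod (u : ℤ_[p]) * PadicInt.toZMod (↑u⁻¹ : ℤ_[p]) = 1 := by
      rw [← map_mul]; simp
    have e : PadicInt.toZMod ((x ^ 2 - (v : ℤ_[p])) * (↑u⁻¹ : ℤ_[p])) = PadicInt.toZMod y ^ 2 := by
      simp only [map_mul, map_sub, map_pow]
      linear_combination PadicInt.toZMod (↑u⁻¹ : ℤ_[p]) * h + PadicInt.toZMod y ^ 2 * hu'
    obtain ⟨t, ht⟩ := PadicInt.isSquare_of_isSquare_toZMod hp (w := (x ^ 2 - (v : ℤ_[p])) * (↑u⁻¹ : ℤ_[p]))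
      (by
        rw [map_mul, map_sub, map_pow, hx]
        simpa using ⟨hv, hu⟩)
      ⟨_, e.trans (sq _)⟩
    refine ⟨x, t, ?_⟩
    linear_combination (x ^ 2 - (v : ℤ_[p])) * u.mul_inv - (u : ℤ_[p]) * ht
  · have e : PadicInt.toZMod ((v : ℤ_[p]) + (u : ℤ_[p]) * y ^ 2) = PadicInt.toZMod x ^ 2 := by
      simp only [map_mul, map_add, map_pow]
      linear_combination -h
    obtain ⟨t, ht⟩ := PadicInt.isSquare_of_isSquare_toZMod hp (w := (v : ℤ_[p]) + (u : ℤ_[p]) * y ^ 2)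
      (by rw [e]; exact pow_ne_zero 2 hx) ⟨_, e.trans (sq _)⟩
    exact ⟨t, y, by linear_combination ht⟩

lemma binaryNormIndexLETwo_padic_of_ne_two (hp : p ≠ 2) : BinaryNormIndexLETwo ℚ_[p] := by
  intro β hβ
  have hp0 : (p : ℚ_[p]) ≠ 0 := Nat.cast_ne_zero.2 (Fact.out : p.Prime).ne_zero
  have unit_ne (u : ℤ_[p]ˣ) : ((u : ℤ_[p]) : ℚ_[p]) ≠ 0 := by
    simp
  obtain ⟨u, s, hs, rfl | rfl⟩ := Padic.exists_unit_mul_sq hβ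
  · have key (v : ℤ_[p]ˣ) : IsBinaryNorm ((u : ℤ_[p]) * s ^ 2) ((v : ℤ_[p]) : ℚ_[p]) :=
      (Padic.isBinaryNorm_units hp u v).congr_left hβ (s := (u : ℤ_[p]) * s) (by ring)
    refine ⟨p, hp0, fun z hz ↦ ?_⟩
    obtain ⟨v, t, ht, rfl | rfl⟩ := Padic.exists_unit_mul_sq hz
    · exact .inl ((key v).mul (isBinaryNorm_sq _ _))
    · refine .inr ?_
      have := (key v).mul (isBinaryNorm_sq _ (p * t))
      rwa [show (p : ℚ_[p]) * (v : ℤ_[p]) * t ^ 2 * p = (v : ℤ_[p]) * (p * t) ^ 2 by ring]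
  · set β : ℚ_[p] := p * (u : ℤ_[p]) * s ^ 2
    obtain ⟨e, he⟩ := FiniteField.exists_nonsquare (F := ZMod p)
      (by rwa [ZMod.ringChar_zmod_n])
    have he0 : e ≠ 0 := by rintro rfl; exact he (.zero)
    obtain ⟨r, rfl⟩ := ZMod.ringHom_surjective (PadicInt.toZMod (p := p)) e
    have hr : (r : ℚ_[p]) ≠ 0 := by
      intro h; apply he0; rw [PadicInt.coe_eq_zero.1 h, map_zero]
    have key (v : ℤ_[p]ˣ) : IsBinaryNorm β ((v : ℤ_[p]) : ℚ_[p]) ∨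
        IsBinaryNorm β (((v : ℤ_[p]) : ℚ_[p]) * r) := by
      have hsq {w : ℤ_[p]} (h : IsSquare w) : IsBinaryNorm β (w : ℚ_[p]) := by
        obtain ⟨t, rfl⟩ := h
        rw [PadicInt.coe_mul, ← sq]
        exact isBinaryNorm_sq _ _
      have hv := PadicInt.toZMod_units_ne_zero v
      by_cases h : IsSquare (PadicInt.toZMod (v : ℤ_[p]))
      · exact .inl (hsq (PadicInt.isSquare_of_isSquare_toZMod hp hv h))
      · refine .inr ?_
        rw [← PadicInt.coe_mul]
        refine hsq (PadicInt.isSquare_of_isSquare_toZMod hp ?_ ?_)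
        · rw [map_mul]; exact mul_ne_zero hv he0
        · rw [map_mul]
          rw [← quadraticChar_neg_one_iff_not_isSquare] at h he
          rw [← quadraticChar_one_iff_isSquare (mul_ne_zero hv he0), map_mul, h, he]
          rfl
    refine ⟨r, hr, fun z hz ↦ ?_⟩
    obtain ⟨v, t, ht, rfl | rfl⟩ := Padic.exists_unit_mul_sq hz
    · refine (key v).imp (fun h ↦ h.mul (isBinaryNorm_sq _ t)) fun h ↦ ?_
      have := h.mul (isBinaryNorm_sq _ t)
      rwa [mul_right_comm]
    · refine (key (-(u * v))).imp (fun h ↦ ?_) fun h ↦ ?_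
      · refine .of_mul_right (neg_ne_zero.2 hβ) ?_ (isBinaryNorm_neg_self β)
        have := h.mul (isBinaryNorm_sq _ (p * s * t))
        convert this using 1
        simp only [β]; push_cast; ring
      · refine .of_mul_right (neg_ne_zero.2 hβ) ?_ (isBinaryNorm_neg_self β)
        have := h.mul (isBinaryNorm_sq _ (p * s * t))
        convert this using 1
        simp only [β]; push_cast; ring

lemma PadicInt.isSquare_of_toZModPow_three_eq_one {w : ℤ_[2]}
    (h : PadicInt.toZModPow 3 w = 1) : IsSquare w := by
  refine PadicInt.isSquare_of_norm_sub_sq_lt (a := 1) ?_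
  have : ‖w - 1‖ ≤ (2 : ℕ) ^ (-(3 : ℕ) : ℤ) := by
    rw [PadicInt.norm_le_pow_iff_mem_span_pow, ← PadicInt.ker_toZModPow, RingHom.mem_ker, map_sub,
      h, map_one, sub_self]
  have h2 : ‖(2 : ℤ_[2])‖ = 2⁻¹ := by simpa using PadicInt.norm_p (p := 2)
  rw [one_pow, mul_one, h2]
  refine this.trans_lt ?_
  norm_num

/-- An integer of the form `8m + 1`, `4(8m + 1)` or `16(8m + 1)` is a square in `ℚ₂`. -/
lemma Padic.exists_sq_eq_intCast {m : ℤ} (h : m % 8 = 1 ∨ m % 32 = 4 ∨ m % 128 = 16) :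
    ∃ s : ℚ_[2], (m : ℚ_[2]) = s ^ 2 := by
  have key (n : ℤ) (hn : n % 8 = 1) : ∃ s : ℚ_[2], (n : ℚ_[2]) = s ^ 2 := by
    obtain ⟨t, ht⟩ := PadicInt.isSquare_of_toZModPow_three_eq_one (w := (n : ℤ_[2])) (by
      rw [map_intCast]
      exact_mod_cast (ZMod.intCast_eq_intCast_iff n 1 8).2 hn)
    exact ⟨t, by rw [← PadicInt.coe_intCast, ht, PadicInt.coe_mul, sq]⟩
  rcases h with h | h | h
  · exact key m h
  · obtain ⟨s, hs⟩ := key (m / 4) (by omega)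
    refine ⟨2 * s, ?_⟩
    rw [mul_pow, ← hs, show m = 4 * (m / 4) by omega]
    push_cast [Int.mul_ediv_cancel_left]
    ring
  · obtain ⟨s, hs⟩ := key (m / 16) (by omega)
    refine ⟨4 * s, ?_⟩
    rw [mul_pow, ← hs, show m = 16 * (m / 16) by omega]
    push_cast [Int.mul_ediv_cancel_left]
    ring

/-- The integers `1, 3, 5, 7, 2, 6, 10, 14` represent all square classes of `ℚ₂`. -/
lemma Padic.exists_mul_intCast_eq_sq {z : ℚ_[2]} (hz : z ≠ 0) :
    ∃ c ∈ ({1, 3, 5, 7, 2, 6, 10, 14} : Finset ℤ), ∃ s : ℚ_[2], z * c = s ^ 2 := by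
  have key (u : ℤ_[2]ˣ) : ∃ c ∈ ({1, 3, 5, 7} : Finset ℤ), ∃ s : ℚ_[2],
      (u : ℤ_[2]) * (c : ℚ_[2]) = s ^ 2 := by
    have hdec : ∀ v : (ZMod (2 ^ 3))ˣ, ∃ c ∈ ({1, 3, 5, 7} : Finset ℤ),
        (v : ZMod (2 ^ 3)) * (c : ZMod (2 ^ 3)) = 1 := by decide
    obtain ⟨c, hc, h⟩ := hdec (u.map (PadicInt.toZModPow 3 : ℤ_[2] →+* _).toMonoidHom)
    obtain ⟨t, ht⟩ := PadicInt.isSquare_of_toZModPow_three_eq_one (w := (u : ℤ_[2]) * (c : ℤ_[2]))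
      (by rw [map_mul, map_intCast]; exact h)
    exact ⟨c, hc, t, by rw [← PadicInt.coe_intCast, ← PadicInt.coe_mul, ht, PadicInt.coe_mul, sq]⟩
  obtain ⟨u, s, hs, rfl | rfl⟩ := Padic.exists_unit_mul_sq hz
  all_goals obtain ⟨c, hc, t, ht⟩ := key u
  · refine ⟨c, ?_, t * s, by linear_combination s ^ 2 * ht⟩
    simp only [Finset.mem_insert, Finset.mem_singleton] at hc ⊢
    tauto
  · refine ⟨2 * c, ?_, 2 * t * s, by push_cast; linear_combination 4 * s ^ 2 * ht⟩
    simp only [Finset.mem_insert, Finset.mem_singleton] at hc ⊢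
    omega

lemma exists_int_sub_mul_sq_mul_mod :
    ∀ b ∈ ({1, 3, 5, 7, 2, 6, 10, 14} : Finset ℤ), ∃ r ∈ ({2, 5, 7} : Finset ℤ),
      ∀ c ∈ ({1, 3, 5, 7, 2, 6, 10, 14} : Finset ℤ), ∃ e ∈ ({1, r} : Finset ℤ),
        ∃ x ∈ Finset.range 5, ∃ y ∈ Finset.range 5,
          (c * e * (x ^ 2 - b * y ^ 2)) % 8 = 1 ∨ (c * e * (x ^ 2 - b * y ^ 2)) % 32 = 4 ∨
            (c * e * (x ^ 2 - b * y ^ 2)) % 128 = 16 := by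
  decide +kernel

lemma binaryNormIndexLETwo_padic_two : BinaryNormIndexLETwo ℚ_[2] := by
  intro β hβ
  obtain ⟨b, hb, s, hs⟩ := Padic.exists_mul_intCast_eq_sq hβ
  obtain ⟨r, hr, H⟩ := exists_int_sub_mul_sq_mul_mod b hb
  have ne_zero {c : ℤ} (hc : c ≠ 0) : (c : ℚ_[2]) ≠ 0 := Int.cast_ne_zero.2 hc
  refine ⟨r, ne_zero (by rintro rfl; simp at hr), fun z hz ↦ ?_⟩
  obtain ⟨c, hc, t, ht⟩ := Padic.exists_mul_intCast_eq_sq hz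
  obtain ⟨e, he, x, -, y, -, h⟩ := H c hc
  have key : IsBinaryNorm β (z * e) := by
    obtain ⟨q, hq⟩ := Padic.exists_sq_eq_intCast h
    have hm : (c * e * (x ^ 2 - b * y ^ 2) : ℤ) ≠ 0 := by rintro h0; rw [h0] at h; simp at h
    push_cast at hq
    refine .congr_left (β := (b : ℚ_[2])) hβ (s := s) (by linear_combination hs) ?_
    refine .of_mul_eq_sq (w := (x : ℚ_[2]) ^ 2 - b * y ^ 2) (s := t * q / c) ?_ ⟨x, y, rfl⟩ ?_
    · exact_mod_cast ne_zero (right_ne_zero_of_mul hm)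
    · have hc0 : (c : ℚ_[2]) ≠ 0 := ne_zero (left_ne_zero_of_mul (left_ne_zero_of_mul hm))
      field_simp
      linear_combination q ^ 2 * ht + z * c * hq
  rcases Finset.mem_insert.1 he with rfl | he
  · exact .inl (by simpa using key)
  · exact .inr (by rwa [Finset.mem_singleton.1 he] at key)

end Padic

lemma QPlace.hone_iff (v : QPlace) : ∃ (K : Type) (_ : Field K) (_ : CharZero K)
    (_ : Algebra ℚ K), BinaryNormIndexLETwo K ∧ ∀ a b, v.Hone a b ↔ HilbertOne K a b := by
  cases v with
  | fin p hp =>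
    have : Fact p.Prime := ⟨hp⟩
    refine ⟨ℚ_[p], inferInstance, inferInstance, inferInstance, ?_, fun _ _ ↦ Iff.rfl⟩
    by_cases h : p = 2
    · subst h; exact binaryNormIndexLETwo_padic_two
    · exact binaryNormIndexLETwo_padic_of_ne_two h
  | inf => exact ⟨ℝ, inferInstance, inferInstance, inferInstance, binaryNormIndexLETwo_real,
      fun _ _ ↦ Iff.rfl⟩

section Quaternion

variable {K : Type*} [Field K]

lemma QuaternionAlgebra.Basis.liftHom_injective {A : Type*} [Ring A] [Nontrivial A] [Algebra K A]
    (h2 : (2 : K) ≠ 0) {c₁ c₃ : K} (h₁ : c₁ ≠ 0) (h₃ : c₃ ≠ 0)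
    (q : QuaternionAlgebra.Basis A c₁ 0 c₃) : Function.Injective q.liftHom := by
  rw [injective_iff_map_eq_zero]
  intro u hu
  set L := q.liftHom
  have hi : L (.mk 0 1 0 0) = q.i := by simp [L, QuaternionAlgebra.Basis.lift]
  have hj : L (.mk 0 0 1 0) = q.j := by simp [L, QuaternionAlgebra.Basis.lift]
  have scalar (c : K) (h : L (.mk c 0 0 0) = 0) : c = 0 := by
    have : algebraMap K A c = 0 := by simpa [L, QuaternionAlgebra.Basis.lift] using h
    simpa using this
  have coord (u : ℍ[K, c₁, c₃]) (hu : L u = 0) : u.re = 0 := by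
    refine (mul_eq_zero.1 (scalar (4 * c₁ * c₃ * u.re) ?_)).resolve_left ?_
    · have e1 : L (.mk 0 1 0 0 * u * .mk 0 1 0 0) = 0 := by simp [hu]
      have e2 : L (.mk 0 0 1 0 * u * .mk 0 0 1 0) = 0 := by simp [hu]
      have e3 : L (.mk 0 0 0 1 * u * .mk 0 0 0 1) = 0 := by simp [hu]
      have e : (.mk (4 * c₁ * c₃ * u.re) 0 0 0 : ℍ[K, c₁, c₃]) =
          (c₁ * c₃) • u + c₃ • (.mk 0 1 0 0 * u * .mk 0 1 0 0) +
          c₁ • (.mk 0 0 1 0 * u * .mk 0 0 1 0) - (.mk 0 0 0 1 * u * .mk 0 0 0 1) := by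
        ext <;> simp <;> ring
      rw [e, map_sub, map_add, map_add, map_smul, map_smul, map_smul, hu, e1, e2, e3]
      simp
    · have : (4 : K) ≠ 0 := by
        rw [show (4 : K) = 2 * 2 by norm_num]; exact mul_ne_zero h2 h2
      exact mul_ne_zero (mul_ne_zero this h₁) h₃
  have z0 := coord u hu
  have z1 := coord (.mk 0 1 0 0 * u) (by simp [hu])
  have z2 := coord (.mk 0 0 1 0 * u) (by simp [hu])
  have z3 := coord (.mk 0 0 0 1 * u) (by simp [hu])
  ext
  · exact z0
  · simpa [h₁] using z1
  · simpa [h₃] using z2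
  · simpa [h₁, h₃] using z3

lemma QuaternionAlgebra.Basis.liftHom_bijective (h2 : (2 : K) ≠ 0) {a b c₁ c₃ : K}
    (h₁ : c₁ ≠ 0) (h₃ : c₃ ≠ 0) (q : QuaternionAlgebra.Basis ℍ[K, a, b] c₁ 0 c₃) :
    Function.Bijective q.liftHom := by
  have hinj := q.liftHom_injective h2 h₁ h₃
  refine ⟨hinj, ?_⟩
  have := LinearMap.injective_iff_surjective_of_finrank_eq_finrank
    (f := q.liftHom.toLinearMap) (by simp [QuaternionAlgebra.finrank_eq_four])
  exact this.1 hinj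

/-- Two anticommuting pure quaternions give a quaternionic basis. -/
def QuaternionAlgebra.Basis.ofPure {R : Type*} [CommRing R] (a b x y z x' y' z' : R)
    (h : a * x * x' + b * y * y' - a * b * z * z' = 0) :
    QuaternionAlgebra.Basis ℍ[R, a, b] (a * x ^ 2 + b * y ^ 2 - a * b * z ^ 2) 0
      (a * x' ^ 2 + b * y' ^ 2 - a * b * z' ^ 2) where
  i := ⟨0, x, y, z⟩
  j := ⟨0, x', y', z'⟩
  k := ⟨0, x, y, z⟩ * ⟨0, x', y', z'⟩
  i_mul_i := by ext <;> simp <;> ring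
  j_mul_j := by ext <;> simp <;> ring
  i_mul_j := rfl
  j_mul_i := by
    ext <;> simp
    · linear_combination 2 * h
    all_goals ring

lemma isBinaryNorm_iff_not_noZeroDivisors (h2 : (2 : K) ≠ 0) {a b : K} (ha : a ≠ 0) :
    IsBinaryNorm a b ↔ ¬ NoZeroDivisors ℍ[K, a, b] := by
  constructor
  · rintro ⟨x, y, rfl⟩ H
    have : (⟨x, y, 1, 0⟩ * ⟨x, -y, -1, 0⟩ : ℍ[K, a, x ^ 2 - a * y ^ 2]) = 0 := by
      ext <;> simp <;> ring
    rcases mul_eq_zero.1 this with h | h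
    · simpa using congrArg QuaternionAlgebra.imJ h
    · simpa using congrArg QuaternionAlgebra.imJ h
  · intro H
    rw [noZeroDivisors_iff] at H
    push Not at H
    obtain ⟨q, r, hqr, hq, hr⟩ := H
    obtain ⟨w, x, y, z⟩ := q
    have hN : w ^ 2 - a * x ^ 2 - b * (y ^ 2 - a * z ^ 2) = 0 := by
      have e : (w ^ 2 - a * x ^ 2 - b * (y ^ 2 - a * z ^ 2)) • r =
          star (⟨w, x, y, z⟩ : ℍ[K, a, b]) * (⟨w, x, y, z⟩ * r) := by
        ext <;> simp <;> ring
      rw [hqr, mul_zero] at e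
      exact (smul_eq_zero.1 e).resolve_right hr
    have split {u v : K} (h : u ^ 2 - a * v ^ 2 = 0) (hv : v ≠ 0) : IsBinaryNorm a b := by
      have e : a = (u / v) ^ 2 := by field_simp; linear_combination -h
      have : u / v ≠ 0 := by intro h0; rw [h0] at e; simp at e; exact ha e
      rw [e]
      exact isBinaryNorm_sq_left h2 this b
    by_cases hyz : y ^ 2 - a * z ^ 2 = 0
    · by_cases hz : z = 0
      · by_cases hx : x = 0
        · exfalso; apply hq
          subst hz hx
          simp at hyz
          subst hyz
          simp at hN
          subst hN
          rfl
        · exact split (u := w) (by linear_combination hN + b * hyz) hx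
      · exact split (u := y) hyz hz
    · exact .of_mul_right hyz ⟨w, x, by linear_combination -hN⟩ ⟨y, z, rfl⟩

/-- A nonisotropic vector of the form `⟨a, b, -ab⟩` has a nonisotropic orthogonal vector. -/
lemma exists_orthogonal_pure {a b x y z : K} (h2 : (2 : K) ≠ 0) (ha : a ≠ 0) (hb : b ≠ 0)
    (h : a * x ^ 2 + b * y ^ 2 - a * b * z ^ 2 ≠ 0) :
    ∃ x' y' z' : K, a * x * x' + b * y * y' - a * b * z * z' = 0 ∧
      a * x' ^ 2 + b * y' ^ 2 - a * b * z' ^ 2 ≠ 0 := by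
  by_contra! H
  have h1 := H (b * y) (-a * x) 0 (by ring)
  have h3 := H (b * z) 0 x (by ring)
  have h4 := H 0 (a * z) y (by ring)
  have e1 : a * x ^ 2 + b * y ^ 2 = 0 :=
    (mul_eq_zero.1 (show a * b * (a * x ^ 2 + b * y ^ 2) = 0 by linear_combination h1)).resolve_left
      (mul_ne_zero ha hb)
  have e3 : b * z ^ 2 - x ^ 2 = 0 :=
    (mul_eq_zero.1 (show a * b * (b * z ^ 2 - x ^ 2) = 0 by linear_combination h3)).resolve_left
      (mul_ne_zero ha hb)
  have e4 : a * z ^ 2 - y ^ 2 = 0 :=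
    (mul_eq_zero.1 (show a * b * (a * z ^ 2 - y ^ 2) = 0 by linear_combination h4)).resolve_left
      (mul_ne_zero ha hb)
  have e5 : z ^ 2 = 0 :=
    (mul_eq_zero.1 (show 2 * a * b * z ^ 2 = 0 by
      linear_combination e1 + a * e3 + b * e4)).resolve_left
      (mul_ne_zero (mul_ne_zero h2 ha) hb)
  exact h (by linear_combination e1 - a * b * e5)

/-- The Hilbert symbol computation: for `x, y, z` with `β = ax² + by² - abz²`, an orthogonal
vector with value `γ` and `n = t² + dβ`, one has `(n, -d) = (a, b)(β, nγ)`. -/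
lemma QPlace.sym_eq_mul_of_orthogonal (v : QPlace) {a b x y z x' y' z' β γ n t d : ℚ}
    (ha : a ≠ 0) (hb : b ≠ 0) (hβ : β ≠ 0) (hγ : γ ≠ 0) (hn : n ≠ 0) (hd : d ≠ 0)
    (eβ : β = a * x ^ 2 + b * y ^ 2 - a * b * z ^ 2)
    (eγ : γ = a * x' ^ 2 + b * y' ^ 2 - a * b * z' ^ 2)
    (h : a * x * x' + b * y * y' - a * b * z * z' = 0) (en : n = t ^ 2 + d * β) :
    v.sym n (-d) = v.sym a b * v.sym β (n * γ) := by
  obtain ⟨K, _, _, _, hK, hv⟩ := v.hone_iff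
  let f := algebraMap ℚ K
  have f0 {c : ℚ} (hc : c ≠ 0) : f c ≠ 0 := by simpa [f] using hc
  have h2 : (2 : K) ≠ 0 := two_ne_zero
  have hone {c e : ℚ} (hc : c ≠ 0) (he : e ≠ 0) : v.Hone c e ↔ IsBinaryNorm (f c) (f e) :=
    (hv c e).trans (exists_mul_sq_add_mul_sq_eq_one_iff h2 (f0 hc) (f0 he))
  have hE : v.Hone a b ↔ IsBinaryNorm (f β) (f γ) := by
    rw [hone ha hb, isBinaryNorm_iff_not_noZeroDivisors h2 (f0 ha),
      isBinaryNorm_iff_not_noZeroDivisors h2 (f0 hβ), not_iff_not]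
    have q := QuaternionAlgebra.Basis.ofPure (f a) (f b) (f x) (f y) (f z) (f x') (f y') (f z')
      (by simpa using congrArg f h)
    have hβ' : f β = f a * f x ^ 2 + f b * f y ^ 2 - f a * f b * f z ^ 2 := by simp [eβ]
    have hγ' : f γ = f a * f x' ^ 2 + f b * f y' ^ 2 - f a * f b * f z' ^ 2 := by simp [eγ]
    rw [← hβ', ← hγ'] at q
    have e := AlgEquiv.ofBijective q.liftHom (q.liftHom_bijective h2 (f0 hβ) (f0 hγ))
    exact ⟨fun _ ↦ e.injective.noZeroDivisors _ (map_zero e) (map_mul e),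
      fun _ ↦ e.symm.injective.noZeroDivisors _ (map_zero e.symm) (map_mul e.symm)⟩
  have hF : v.Hone β (n * γ) ↔ IsBinaryNorm (f β) (f n * f γ) := by
    rw [hone hβ (mul_ne_zero hn hγ), map_mul]
  have hnd : v.Hone n (-d) ↔ IsBinaryNorm (f β) (f n) := by
    rw [hone hn (neg_ne_zero.2 hd), isBinaryNorm_comm h2 (f0 hβ) (f0 hn)]
    have key : IsBinaryNorm (f n) (f (-d) * f β) := by
      rw [isBinaryNorm_comm h2 (f0 hn) (mul_ne_zero (f0 (neg_ne_zero.2 hd)) (f0 hβ))]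
      exact ⟨f t, 1, by simp [en]⟩
    exact ⟨fun H ↦ .of_mul_right (f0 (neg_ne_zero.2 hd)) (by rwa [mul_comm]) H,
      fun H ↦ .of_mul_right (f0 hβ) key H⟩
  have h1 : IsBinaryNorm (f β) (f n) → (IsBinaryNorm (f β) (f γ) ↔
      IsBinaryNorm (f β) (f n * f γ)) := fun H ↦
    ⟨H.mul, fun H' ↦ .of_mul_right (f0 hn) (by rwa [mul_comm]) H⟩
  have h3 : IsBinaryNorm (f β) (f γ) → IsBinaryNorm (f β) (f n * f γ) →
      IsBinaryNorm (f β) (f n) := fun H H' ↦ .of_mul_right (f0 hγ) H' H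
  have h4 := hK.isBinaryNorm_mul (f0 hβ) (f0 hn) (f0 hγ)
  unfold QPlace.sym
  simp only [hE, hF, hnd]
  split_ifs <;> first | rfl | tauto

end Quaternion

section QuadraticExtension

variable {d : ℕ}

lemma irreducible_X_sq_add_C (hd : 1 ≤ d) :
    Irreducible ((Polynomial.X : ℚ[X]) ^ 2 + Polynomial.C (d : ℚ)) := by
  have hdeg : ((Polynomial.X : ℚ[X]) ^ 2 + Polynomial.C (d : ℚ)).natDegree = 2 :=
    Polynomial.natDegree_X_pow_add_C
  refine Polynomial.irreducible_of_degree_le_three_of_not_isRoot (by rw [hdeg]; decide) fun x hx ↦ ?_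
  simp only [Polynomial.IsRoot, Polynomial.eval_add, Polynomial.eval_pow, Polynomial.eval_X,
    Polynomial.eval_C] at hx
  have : (1 : ℚ) ≤ d := by exact_mod_cast hd
  nlinarith [sq_nonneg x]

lemma QkRoot_sq : QkRoot d ^ 2 = -algebraMap ℚ (Qk d) d := by
  have := AdjoinRoot.eval₂_root ((Polynomial.X : ℚ[X]) ^ 2 + Polynomial.C (d : ℚ))
  rw [Polynomial.eval₂_add, Polynomial.eval₂_X_pow, Polynomial.eval₂_C] at this
  exact eq_neg_of_add_eq_zero_left this

lemma Qk.exists_eq_add_mul_root (c : Qk d) :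
    ∃ p q : ℚ, c = algebraMap ℚ (Qk d) p + algebraMap ℚ (Qk d) q * QkRoot d := by
  induction c using AdjoinRoot.induction_on with | ih f =>
  induction f using Polynomial.induction_on with
  | C a => exact ⟨a, 0, by simp [AdjoinRoot.algebraMap_eq]⟩
  | add f g hf hg =>
    obtain ⟨p, q, h⟩ := hf
    obtain ⟨p', q', h'⟩ := hg
    exact ⟨p + p', q + q', by rw [map_add, h, h']; simp only [map_add]; ring⟩
  | monomial n a h =>
    obtain ⟨p, q, h⟩ := h
    refine ⟨-(d * q), p, ?_⟩
    rw [pow_succ _ n, ← mul_assoc, map_mul, h, AdjoinRoot.mk_X]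
    have := QkRoot_sq (d := d)
    change _ * QkRoot d = _
    simp only [map_neg, map_mul]
    linear_combination algebraMap ℚ (Qk d) q * this

end QuadraticExtension

section FixedAlgebra

lemma mem_FET_iff {M : Type*} [Ring M] [Algebra ℚ M] {Φ : M ≃ₐ[ℚ] M} {T : Mˣ} {A : M} :
    A ∈ FET Φ T ↔ (T : M) * Φ A = A * T :=
  Units.mul_inv_eq_iff_eq_mul T

/-- The extension of scalars `ℍ[R,a,b] → ℍ[S,a,b]`. -/
def QuaternionAlgebra.mapAlgHom {R : Type*} (S : Type*) [CommRing R] [CommRing S] [Algebra R S]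
    (a b : R) : ℍ[R, a, b] →ₐ[R] ℍ[S, algebraMap R S a, algebraMap R S b] where
  toFun u := ⟨algebraMap R S u.re, algebraMap R S u.imI, algebraMap R S u.imJ,
    algebraMap R S u.imK⟩
  map_one' := by ext <;> simp
  map_mul' u v := by ext <;> simp
  map_zero' := by ext <;> simp
  map_add' u v := by ext <;> simp
  commutes' r := by ext <;> simp [Algebra.algebraMap_eq_smul_one]

lemma QuaternionAlgebra.mapAlgHom_injective {R S : Type*} [CommRing R] [CommRing S] [Algebra R S]
    (h : Function.Injective (algebraMap R S)) (a b : R) :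
    Function.Injective (mapAlgHom S a b) := fun _ _ e ↦
  QuaternionAlgebra.ext (h (congrArg re e)) (h (congrArg imI e)) (h (congrArg imJ e))
    (h (congrArg imK e))

lemma QuaternionAlgebra.star_mapAlgHom {R : Type*} (S : Type*) [CommRing R] [CommRing S]
    [Algebra R S] (a b : R) (u : ℍ[R, a, b]) :
    star (mapAlgHom S a b u) = mapAlgHom S a b (star u) := by
  ext <;> simp [mapAlgHom]

lemma QuaternionAlgebra.exists_eq_mapAlgHom_add_smul {R S : Type*} [CommRing R] [CommRing S]
    [Algebra R S] {s : S} (h : ∀ c : S, ∃ p q : R, c = algebraMap R S p + algebraMap R S q * s)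
    (a b : R) (A : ℍ[S, algebraMap R S a, algebraMap R S b]) :
    ∃ u v, A = mapAlgHom S a b u + s • (1 : ℍ[S, algebraMap R S a, algebraMap R S b]) *
      mapAlgHom S a b v := by
  obtain ⟨w₁, w₂, hw⟩ := h A.re
  obtain ⟨x₁, x₂, hx⟩ := h A.imI
  obtain ⟨y₁, y₂, hy⟩ := h A.imJ
  obtain ⟨z₁, z₂, hz⟩ := h A.imK
  refine ⟨⟨w₁, x₁, y₁, z₁⟩, ⟨w₂, x₂, y₂, z₂⟩, ?_⟩
  ext <;> simp [mapAlgHom, mul_comm s, *]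

lemma smul_one_mul_smul_one_of_sq_eq_neg {R S A : Type*} [CommRing R] [CommRing S] [Algebra R S]
    [Ring A] [Algebra S A] [Algebra R A] [IsScalarTower R S A] {s : S} {r : R}
    (h : s ^ 2 = -algebraMap R S r) : s • (1 : A) * s • (1 : A) = -(r • (1 : A)) := by
  rw [smul_mul_smul_comm, mul_one, ← sq, h, neg_smul, algebraMap_smul]

lemma mul_smul_one_comm {S A : Type*} [CommRing S] [Ring A] [Algebra S A] (s : S) (x : A) :
    x * s • (1 : A) = s • (1 : A) * x := by
  rw [mul_smul_comm, smul_mul_assoc, one_mul, mul_one]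

lemma QuaternionAlgebra.star_smul_one {S : Type*} [CommRing S] {a b : S} (s : S) :
    star (s • (1 : ℍ[S, a, b])) = s • (1 : ℍ[S, a, b]) := by
  rw [QuaternionAlgebra.star_smul, star_one]

variable {M : Type*} [Ring M] [Algebra ℚ M] {a b : ℚ} {ι : ℍ[ℚ, a, b] →ₐ[ℚ] M} {σ : M} {d : ℚ}
  {Φ : M ≃ₐ[ℚ] M}

lemma eq_zero_of_add_root_mul_eq_zero (hd : d ≠ 0) (hσσ : σ * σ = -(d • (1 : M)))
    {X Y : M} (h : X + σ * Y = 0) (h' : X - σ * Y = 0) : X = 0 ∧ Y = 0 := by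
  have hX : X = 0 := by
    have : (2 : ℚ) • X = 0 := by
      rw [two_smul, show X + X = X + σ * Y + (X - σ * Y) by abel, h, h', add_zero]
    exact (smul_eq_zero.1 this).resolve_left two_ne_zero
  refine ⟨hX, ?_⟩
  rw [hX, zero_add] at h
  have : d • Y = 0 := by
    have := congrArg (σ * ·) h
    simpa [← mul_assoc, hσσ] using this
  exact (smul_eq_zero.1 this).resolve_left hd

/-- If `M` is generated over `E` by a central square root `σ` of `-d` with `Φ σ = -σ`, then a pair
of anticommuting elements of `F(E,T)` with nonzero rational squares identifies `F(E,T)` with a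
rational quaternion algebra. -/
lemma nonempty_algEquiv_FET [Nontrivial M] (hd : d ≠ 0) (hσσ : σ * σ = -(d • (1 : M)))
    (hσ : ∀ A, A * σ = σ * A) (hspan : ∀ A, ∃ u v, A = ι u + σ * ι v) (hΦσ : Φ σ = -σ)
    (T : Mˣ) {c₁ c₃ : ℚ} (h₁ : c₁ ≠ 0) (h₃ : c₃ ≠ 0) {I J : M}
    (hI : I ∈ FET Φ T) (hJ : J ∈ FET Φ T) (hII : I * I = c₁ • (1 : M))
    (hJJ : J * J = c₃ • (1 : M)) (hJI : J * I = -(I * J)) :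
    Nonempty (ℍ[ℚ, c₁, c₃] ≃ₐ[ℚ] FET Φ T) := by
  let q : QuaternionAlgebra.Basis (FET Φ T) c₁ 0 c₃ :=
    { i := ⟨I, hI⟩
      j := ⟨J, hJ⟩
      k := ⟨I, hI⟩ * ⟨J, hJ⟩
      i_mul_i := Subtype.ext (by simpa using hII)
      j_mul_j := Subtype.ext (by simpa using hJJ)
      i_mul_j := rfl
      j_mul_i := Subtype.ext (by simpa using hJI) }
  have hq := q.liftHom_injective two_ne_zero h₁ h₃
  let L : ℍ[ℚ, a, b] × ℍ[ℚ, a, b] →ₗ[ℚ] M :=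
    ι.toLinearMap.coprod (LinearMap.mulLeft ℚ σ ∘ₗ ι.toLinearMap)
  have hL : Function.Surjective L := fun A ↦ by
    obtain ⟨u, v, h⟩ := hspan A
    exact ⟨(u, v), h.symm⟩
  have : FiniteDimensional ℚ M := Module.Finite.of_surjective L hL
  let F := Subalgebra.toSubmodule (FET Φ T)
  let L' : F × F →ₗ[ℚ] M := F.subtype.coprod (LinearMap.mulLeft ℚ σ ∘ₗ F.subtype)
  have hL' : Function.Injective L' := by
    rw [injective_iff_map_eq_zero]
    rintro ⟨⟨X, hX⟩, ⟨Y, hY⟩⟩ h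
    replace h : X + σ * Y = 0 := h
    have hX' : (T : M) * Φ X = X * T := mem_FET_iff.1 hX
    have hY' : (T : M) * Φ Y = Y * T := mem_FET_iff.1 hY
    have h' : X - σ * Y = 0 := by
      have := congrArg (fun A ↦ (T : M) * Φ A) h
      simp only [map_add, map_mul, hΦσ, mul_add, neg_mul, mul_neg, map_zero, mul_zero] at this
      rw [← mul_assoc, hσ, mul_assoc, hX', hY', ← mul_assoc, ← sub_eq_add_neg, ← sub_mul] at this
      simpa using this
    obtain ⟨rfl, rfl⟩ := eq_zero_of_add_root_mul_eq_zero hd hσσ h h'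
    rfl
  have h8 := (LinearMap.finrank_le_finrank_of_injective hL').trans
    (LinearMap.finrank_le_finrank_of_surjective hL)
  rw [Module.finrank_prod, Module.finrank_prod, QuaternionAlgebra.finrank_eq_four] at h8
  have h4 := LinearMap.finrank_le_finrank_of_injective (f := q.liftHom.toLinearMap) hq
  rw [QuaternionAlgebra.finrank_eq_four] at h4
  have hsurj := (LinearMap.injective_iff_surjective_of_finrank_eq_finrank
    (f := q.liftHom.toLinearMap) (by
      rw [QuaternionAlgebra.finrank_eq_four]
      exact le_antisymm h4 (by change Module.finrank ℚ F ≤ 4; omega))).1 hq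
  exact ⟨AlgEquiv.ofBijective q.liftHom ⟨hq, hsurj⟩⟩


/-- The relation `Φ T = T*` forces `T = t + σ B` with `t` rational and `B` a pure rational
quaternion. -/
lemma exists_eq_smul_one_add_root_mul [StarRing M] (hd : d ≠ 0) (hι : Function.Injective ι)
    (hσσ : σ * σ = -(d • (1 : M))) (hσ : ∀ A, A * σ = σ * A) (hΦι : ∀ u, Φ (ι u) = ι u)
    (hΦσ : Φ σ = -σ) (hspan : ∀ A, ∃ u v, A = ι u + σ * ι v)
    (hstarι : ∀ u, star (ι u) = ι (star u)) (hstarσ : star σ = σ)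
    {T : M} (hT : Φ T = star T) :
    ∃ t x y z : ℚ, T = t • (1 : M) + σ * ι ⟨0, x, y, z⟩ := by
  obtain ⟨u, v, rfl⟩ := hspan T
  simp only [map_add, map_mul, hΦι, hΦσ, star_add, star_mul, hstarι, hstarσ, hσ] at hT
  have h : ι (u - star u) + σ * ι (-(v + star v)) = 0 := by
    simp only [map_sub, map_neg, map_add, mul_add, mul_neg]
    rw [← sub_eq_zero] at hT
    rw [← hT]
    noncomm_ring
  have h' : ι (u - star u) - σ * ι (-(v + star v)) = 0 := by
    have := congrArg Φ h
    simpa [hΦι, hΦσ, ← sub_eq_add_neg] using this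
  obtain ⟨hu, hv⟩ := eq_zero_of_add_root_mul_eq_zero hd hσσ h h'
  have hu' := (map_eq_zero_iff ι hι).1 hu
  have hv' := (map_eq_zero_iff ι hι).1 hv
  obtain ⟨w₁, x₁, y₁, z₁⟩ := u
  obtain ⟨w₂, x₂, y₂, z₂⟩ := v
  obtain ⟨-, hx, hy, hz⟩ := QuaternionAlgebra.ext_iff.1 hu'
  obtain ⟨hw, -, -, -⟩ := QuaternionAlgebra.ext_iff.1 hv'
  simp only [QuaternionAlgebra.star_mk, zero_mul, add_zero, QuaternionAlgebra.mk_sub_mk,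
    sub_neg_eq_add,
    QuaternionAlgebra.imI_zero, add_self_eq_zero, QuaternionAlgebra.imJ_zero,
    QuaternionAlgebra.imK_zero, QuaternionAlgebra.mk_add_mk, QuaternionAlgebra.neg_mk, neg_add_rev,
    QuaternionAlgebra.re_zero, neg_eq_zero] at hx hy hz hw
  subst hx hy hz hw
  refine ⟨w₁, x₂, y₂, z₂, ?_⟩
  rw [← Algebra.algebraMap_eq_smul_one, ← ι.commutes]
  rfl

/-- The algebra `F(E,T)` is a rational quaternion algebra whose Hilbert symbol differs from that of
`E` by `(N(T),-d)`, for an abstract ring `M = E + σE` with `σ² = -d` central. -/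
theorem exists_quaternionAlgebra_equiv_FET [StarRing M] (ha : a ≠ 0) (hb : b ≠ 0) (hd : d ≠ 0)
    (hι : Function.Injective ι)
    (hσσ : σ * σ = -(d • (1 : M))) (hσ : ∀ A, A * σ = σ * A) (hΦι : ∀ u, Φ (ι u) = ι u)
    (hΦσ : Φ σ = -σ) (hspan : ∀ A, ∃ u v, A = ι u + σ * ι v)
    (hstarι : ∀ u, star (ι u) = ι (star u)) (hstarσ : star σ = σ)
    (T : Mˣ) (hT : Φ T = star (T : M)) :
    ∃ a' b' : ℚ, a' ≠ 0 ∧ b' ≠ 0 ∧ Nonempty (ℍ[ℚ, a', b'] ≃ₐ[ℚ] FET Φ T) ∧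
      ∃ n : ℚ, n ≠ 0 ∧ (T : M) * star (T : M) = algebraMap ℚ M n ∧
        ∀ v : QPlace, v.sym n (-d) = v.sym a b * v.sym a' b' := by
  have : Nontrivial M := hι.nontrivial
  obtain ⟨t, x, y, z, hTB⟩ := exists_eq_smul_one_add_root_mul hd hι hσσ hσ hΦι hΦσ hspan hstarι
    hstarσ hT
  set β : ℚ := a * x ^ 2 + b * y ^ 2 - a * b * z ^ 2 with hβ
  set B : M := ι ⟨0, x, y, z⟩ with hB
  have sq_ι (x y z : ℚ) : ι ⟨0, x, y, z⟩ * ι ⟨0, x, y, z⟩ =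
      (a * x ^ 2 + b * y ^ 2 - a * b * z ^ 2) • (1 : M) := by
    rw [← map_mul, ← map_one ι, ← map_smul]
    congr 1
    ext <;> simp <;> ring
  have hBB : B * B = β • (1 : M) := sq_ι x y z
  have hBσ : B * σ = σ * B := hσ B
  have hTstar : star (T : M) = t • 1 - σ * B := by
    rw [← hT, hTB]; simp [hΦσ, hΦι, hB, sub_eq_add_neg]
  have hσBσB : σ * B * (σ * B) = -(d * β) • (1 : M) := by
    rw [mul_assoc, ← mul_assoc B, hBσ, mul_assoc, hBB, ← mul_assoc, hσσ, mul_smul_comm, mul_one,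
      smul_neg, smul_smul, mul_comm, neg_smul]
  set n : ℚ := t ^ 2 + d * β with hn
  have hTT : (T : M) * star (T : M) = n • 1 := by
    rw [hTstar, hTB]
    simp only [mul_sub, add_mul, smul_mul_assoc, mul_smul_comm, hσBσB, one_mul, mul_one]
    rw [hn]
    module
  have hn0 : n ≠ 0 := by
    intro h
    rw [h, zero_smul, Units.mul_right_eq_zero, star_eq_zero] at hTT
    exact T.ne_zero hTT
  have hfin := hTT.trans (Algebra.algebraMap_eq_smul_one n).symm
  by_cases hβ0 : β = 0
  · have ht : t ≠ 0 := by rintro rfl; simp [hn, hβ0] at hn0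
    have ht2 : n = t ^ 2 := by rw [hn, hβ0]; ring
    set W : M := (1 / (2 * t)) • (σ * B) with hW
    have hWW : W * W = 0 := by
      rw [hW, smul_mul_assoc, mul_smul_comm, hσBσB, hβ0]; simp
    have hΦW : Φ W = -W := by rw [hW]; simp [hΦσ, hΦι, hB]
    set U : M := 1 + W with hU
    set V : M := 1 - W with hV
    have hUV : U * V = 1 := by
      rw [hU, hV, mul_sub, add_mul, add_mul, hWW]; simp
    have hVU : V * U = 1 := by
      rw [hU, hV, mul_add, sub_mul, sub_mul, hWW]; simp
    have hΦU : Φ U = V := by simp [hU, hV, hΦW, sub_eq_add_neg]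
    have hΦV : Φ V = U := by simp [hU, hV, hΦW]
    have hTU : (T : M) = t • (U * U) := by
      rw [hTB, hU, mul_add, add_mul, add_mul, hWW, hW]
      simp only [one_mul, mul_one, add_zero, smul_add, smul_smul]
      rw [add_assoc, ← add_smul]
      congr 1
      rw [show t * (1 / (2 * t)) + t * (1 / (2 * t)) = 1 by field_simp; norm_num, one_smul]
    have mem (u : ℍ[ℚ, a, b]) : U * ι u * V ∈ FET Φ T := by
      rw [mem_FET_iff, map_mul, map_mul, hΦU, hΦV, hΦι, hTU, smul_mul_assoc, mul_smul_comm]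
      congr 1
      calc U * U * (V * ι u * U) = U * (U * V) * ι u * U := by simp only [mul_assoc]
        _ = U * ι u * (V * U) * U := by rw [hUV, hVU, mul_one, mul_one]
        _ = U * ι u * V * (U * U) := by simp only [mul_assoc]
    have conj (u v : ℍ[ℚ, a, b]) : U * ι u * V * (U * ι v * V) = U * ι (u * v) * V := by
      calc U * ι u * V * (U * ι v * V) = U * ι u * (V * U) * ι v * V := by simp only [mul_assoc]
        _ = U * ι (u * v) * V := by rw [hVU, mul_one, map_mul, mul_assoc U]
    refine ⟨a, b, ha, hb, ?_, n, hn0, hfin, fun v ↦ ?_⟩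
    · refine nonempty_algEquiv_FET hd hσσ hσ hspan hΦσ T ha hb (mem ⟨0, 1, 0, 0⟩)
        (mem ⟨0, 0, 1, 0⟩) ?_ ?_ ?_
      · rw [conj, show (⟨0, 1, 0, 0⟩ * ⟨0, 1, 0, 0⟩ : ℍ[ℚ, a, b]) = a • 1 by ext <;> simp,
          map_smul, map_one, mul_smul_comm, smul_mul_assoc, mul_one, hUV]
      · rw [conj, show (⟨0, 0, 1, 0⟩ * ⟨0, 0, 1, 0⟩ : ℍ[ℚ, a, b]) = b • 1 by ext <;> simp,
          map_smul, map_one, mul_smul_comm, smul_mul_assoc, mul_one, hUV]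
      · rw [conj, conj, show (⟨0, 0, 1, 0⟩ * ⟨0, 1, 0, 0⟩ : ℍ[ℚ, a, b]) =
          -(⟨0, 1, 0, 0⟩ * ⟨0, 0, 1, 0⟩) by ext <;> simp, map_neg, mul_neg, neg_mul]
    · have h1 : v.Hone n (-d) := by
        cases v <;> exact ⟨algebraMap ℚ _ (1 / t), 0, by
          rw [ht2, ← map_pow, ← map_mul]; simp [ht]⟩
      unfold QPlace.sym
      rw [if_pos h1]
      split_ifs <;> rfl
  · obtain ⟨x', y', z', horth, hγ⟩ := exists_orthogonal_pure two_ne_zero ha hb hβ0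
    set γ : ℚ := a * x' ^ 2 + b * y' ^ 2 - a * b * z' ^ 2 with hγ'
    set C : M := ι ⟨0, x', y', z'⟩ with hC
    have hCC : C * C = γ • (1 : M) := sq_ι x' y' z'
    have hCB : C * B = -(B * C) := by
      rw [hC, hB, ← map_mul, ← map_mul, ← map_neg]
      congr 1
      ext <;> simp
      · linear_combination 2 * horth
      all_goals ring
    have hTB' : (T : M) * B = B * T := by
      rw [hTB]; simp [mul_add, add_mul, ← mul_assoc, hBσ]
    have hCT : C * T = star (T : M) * C := by
      rw [hTstar, hTB]
      rw [mul_add, sub_mul, mul_smul_comm, mul_one, smul_mul_assoc, one_mul, ← mul_assoc, hσ,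
        mul_assoc, hCB, mul_neg, mul_assoc, sub_eq_add_neg]
    refine ⟨β, n * γ, hβ0, mul_ne_zero hn0 hγ, ?_, n, hn0, hfin, fun v ↦
      v.sym_eq_mul_of_orthogonal ha hb hβ0 hγ hn0 hd hβ hγ' horth hn⟩
    refine nonempty_algEquiv_FET hd hσσ hσ hspan hΦσ T hβ0 (mul_ne_zero hn0 hγ) (I := B)
      (J := (T : M) * C) ?_ ?_ hBB ?_ ?_
    · rw [mem_FET_iff, hB, hΦι, ← hB, hTB']
    · rw [mem_FET_iff, map_mul, hT, hC, hΦι, ← hC, ← hCT, mul_assoc]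
    · rw [mul_assoc, ← mul_assoc C, hCT, mul_assoc _ C C, hCC, ← mul_assoc, hTT, mul_smul_comm,
        mul_one, smul_smul, mul_comm]
    · rw [mul_assoc, hCB, mul_neg, ← mul_assoc, hTB', mul_assoc]

end FixedAlgebra

/-- Satz Item06 (ii).  Let `d ∈ ℕ` be squarefree, `k = ℚ(i√d)`,
`E = ℍ[ℚ,a,b]`, `M = k ⊗_ℚ E = ℍ[k,a,b]`, `Φ = Φ_E` the associated involution of `M`
(characterized by fixing `E` pointwise and sending `i√d ↦ -i√d`), and `T ∈ M^×` with
`Φ(T) = T*`.  Then `F(E,T) = {A ∈ M | T·Φ(A)·T⁻¹ = A}` is a quaternion algebra over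
`ℚ`, the reduced norm `N(T) = T·T*` lies in `ℚ^×`, and at every place `v` of `ℚ` one
has the Hilbert symbol identity `(N(T),−d)_v = (E/v)·(F(E,T)/v)`. -/
theorem stmt_7 (d : ℕ) (hd : Squarefree d) (hd1 : 1 ≤ d)
    (a b : ℚ) (ha : a ≠ 0) (hb : b ≠ 0)
    (Φ : Mq d a b ≃ₐ[ℚ] Mq d a b)
    (hΦfix : ∀ A : Mq d a b, IsRatQuat d a b A → Φ A = A)
    (hΦroot : Φ (QkRoot d • (1 : Mq d a b)) = -(QkRoot d • (1 : Mq d a b)))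
    (T : (Mq d a b)ˣ) (hT : Φ (T : Mq d a b) = star (T : Mq d a b)) :
    ∃ a' b' : ℚ, a' ≠ 0 ∧ b' ≠ 0 ∧
      Nonempty (ℍ[ℚ, a', b'] ≃ₐ[ℚ] (FET Φ T)) ∧
      ∃ n : ℚ, n ≠ 0 ∧
        (T : Mq d a b) * star (T : Mq d a b) = algebraMap ℚ (Mq d a b) n ∧
        ∀ v : QPlace, v.sym n (-(d : ℚ)) = v.sym a b * v.sym a' b' := by
  have : Fact (Irreducible ((Polynomial.X : ℚ[X]) ^ 2 + Polynomial.C (d : ℚ))) :=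
    ⟨irreducible_X_sq_add_C hd1⟩
  refine exists_quaternionAlgebra_equiv_FET (ι := QuaternionAlgebra.mapAlgHom (Qk d) a b)
    (σ := QkRoot d • (1 : Mq d a b)) (d := (d : ℚ)) ha hb (by positivity) ?_ ?_ ?_
    (fun u ↦ hΦfix _ ⟨_, _, _, _, rfl⟩) hΦroot ?_ ?_ ?_ T hT
  · exact QuaternionAlgebra.mapAlgHom_injective (algebraMap ℚ (Qk d)).injective a b
  · exact smul_one_mul_smul_one_of_sq_eq_neg QkRoot_sq
  · exact mul_smul_one_comm (QkRoot d)
  · exact QuaternionAlgebra.exists_eq_mapAlgHom_add_smul Qk.exists_eq_add_mul_root a b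
  · exact QuaternionAlgebra.star_mapAlgHom (Qk d) a b
  · exact QuaternionAlgebra.star_smul_one (QkRoot d)
end

section
/- Let d ∈ ℕ be squarefree, k = ℚ(i√d), E a ℚ-quaternion algebra and M = k ⊗_ℚ E. Every ℚ-quaternion subalgebra F ⊂ M with k·F = M is of the form F = F(E,T) for some T ∈ M^× with Φ_E(T) = T*, and T is unique up to a factor in ℚ^×. -/
open scoped Quaternion Classical Polynomial TensorProduct

section Intertwiner

variable {K : Type*} [CommRing K] {M : Type*} [Ring M] [Algebra K M]

/-- The average of `X` over the group generated by two pairs of anticommuting elements,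
with denominators cleared. -/
def intertwiner (p q : K) (u v u' v' X : M) : M :=
  (p * q) • X + q • (u * X * u') + p • (v * X * v') - u * v * X * (u' * v')

theorem mul_intertwiner {p q : K} {u v u' v' : M} (hu : u * u = p • 1) (hv : v * v = q • 1)
    (huv : u * v = -(v * u)) (hu' : u' * u' = p • 1) (hv' : v' * v' = q • 1)
    (huv' : u' * v' = -(v' * u')) (X : M) :
    u * intertwiner p q u v u' v' X = intertwiner p q u v u' v' X * u' ∧
      v * intertwiner p q u v u' v' X = intertwiner p q u v u' v' X * v' := by
  have hvu : ∀ X, v * (u * X) = -(u * (v * X)) := fun X => by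
    rw [← mul_assoc u, huv, neg_mul, neg_neg, mul_assoc]
  have hvu' : v' * u' = -(u' * v') := by rw [huv', neg_neg]
  have huu : ∀ X, u * (u * X) = p • X := fun X => by rw [← mul_assoc, hu]; simp
  have hvv : ∀ X, v * (v * X) = q • X := fun X => by rw [← mul_assoc, hv]; simp
  have huu' : ∀ X, u' * (u' * X) = p • X := fun X => by rw [← mul_assoc, hu']; simp
  constructor
  all_goals
    simp only [intertwiner, mul_add, mul_sub, add_mul, sub_mul, mul_smul_comm, smul_mul_assoc,
      mul_assoc, huu, hvv, hvu, hvu', hu', hv', huu', mul_neg, mul_one]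
    module

theorem sum_intertwiner_mul (a b p q : K) (u v u' v' i j k : M) :
    (a * b) • intertwiner p q u v u' v' 1 + b • (intertwiner p q u v u' v' i * i)
        + a • (intertwiner p q u v u' v' j * j) - intertwiner p q u v u' v' k * k
      = (p * q) • ((a * b) • 1 + b • (i * i) + a • (j * j) - k * k)
        + q • (u * ((a * b) • u' + b • (i * u' * i) + a • (j * u' * j) - k * u' * k))
        + p • (v * ((a * b) • v' + b • (i * v' * i) + a • (j * v' * j) - k * v' * k))
        - u * v * ((a * b) • (u' * v') + b • (i * (u' * v') * i) + a • (j * (u' * v') * j)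
          - k * (u' * v') * k) := by
  simp only [intertwiner, mul_add, mul_sub, add_mul, sub_mul, smul_mul_assoc, mul_smul_comm,
    mul_one, mul_assoc]
  module

end Intertwiner

namespace QuaternionAlgebra

section CommRing

variable {K : Type*} [CommRing K] {a b : K}

theorem mk_eq_sum_basis (r s t u : K) : (⟨r, s, t, u⟩ : ℍ[K,a,b])
    = r • ⟨1, 0, 0, 0⟩ + s • ⟨0, 1, 0, 0⟩ + t • ⟨0, 0, 1, 0⟩ + u • ⟨0, 0, 0, 1⟩ := by
  ext <;> simp

theorem star_mk_zero (r s t u : K) : star (⟨r, s, t, u⟩ : ℍ[K,a,b]) = ⟨r, -s, -t, -u⟩ := by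
  ext <;> simp

theorem sum_conj_basis (x : ℍ[K,a,b]) :
    (a * b) • x + b • ((⟨0, 1, 0, 0⟩ : ℍ[K,a,b]) * x * ⟨0, 1, 0, 0⟩)
      + a • ((⟨0, 0, 1, 0⟩ : ℍ[K,a,b]) * x * ⟨0, 0, 1, 0⟩)
      - (⟨0, 0, 0, 1⟩ : ℍ[K,a,b]) * x * ⟨0, 0, 0, 1⟩ = (4 * a * b * x.re) • 1 := by
  ext <;> simp <;> ring

theorem re_mul_comm (x y : ℍ[K,a,b]) : (x * y).re = (y * x).re := by
  simp; ring

theorem eq_zero_of_forall_re_mul_eq_zero [NoZeroDivisors K] (ha : a ≠ 0) (hb : b ≠ 0)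
    {x : ℍ[K,a,b]}
    (h : ∀ y, (x * y).re = 0) : x = 0 := by
  have h1 := h 1
  have h2 := h ⟨0, 1, 0, 0⟩
  have h3 := h ⟨0, 0, 1, 0⟩
  have h4 := h ⟨0, 0, 0, 1⟩
  ext <;> simp_all

variable [IsDomain K] [CharZero K]

theorem eq_re_smul_one_of_forall_commute (ha : a ≠ 0) {x : ℍ[K,a,b]}
    (h : ∀ y, x * y = y * x) : x = x.re • 1 := by
  ext
  · simp
  · have := congrArg imK (h ⟨0, 0, 1, 0⟩)
    simp at this ⊢
    have h2 : 2 * x.imI = 0 := by linear_combination this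
    simpa using h2
  · have := congrArg imK (h ⟨0, 1, 0, 0⟩)
    simp at this ⊢
    have h2 : 2 * x.imJ = 0 := by linear_combination -this
    simpa using h2
  · have := congrArg imJ (h ⟨0, 1, 0, 0⟩)
    simp at this ⊢
    have h2 : 2 * a * x.imK = 0 := by linear_combination -this
    simpa [ha] using h2

theorem eq_zero_or_eq_zero_of_forall_mul_mul_eq_zero (ha : a ≠ 0) (hb : b ≠ 0)
    {x y : ℍ[K,a,b]} (h : ∀ z, x * z * y = 0) : x = 0 ∨ y = 0 := by
  refine or_iff_not_imp_right.2 fun hy => ?_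
  obtain ⟨g, hg⟩ : ∃ g, (y * g).re ≠ 0 := by
    by_contra! hc
    exact hy (eq_zero_of_forall_re_mul_eq_zero ha hb hc)
  have key : ∀ e f : ℍ[K,a,b], x * (e * (y * g) * f) = 0 := fun e f => by
    rw [show x * (e * (y * g) * f) = x * e * y * (g * f) by simp only [mul_assoc], h, zero_mul]
  have h1 := congrArg (x * ·) (sum_conj_basis (y * g))
  have h0 : x * (y * g) = 0 := by simpa using key 1 1
  simp only [mul_add, mul_sub, mul_smul_comm, key, h0, mul_one] at h1
  have h4 : 4 * a * b * (y * g).re ≠ 0 :=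
    mul_ne_zero (mul_ne_zero (mul_ne_zero (by exact_mod_cast (show (4 : ℕ) ≠ 0 by decide)) ha) hb) hg
  simpa only [smul_zero, add_zero, sub_zero, eq_comm (a := (0 : ℍ[K,a,b])), smul_eq_zero, h4,
    false_or] using h1

/-- Skolem–Noether for two pairs of generators, without invertibility of the intertwiner. -/
theorem exists_intertwiner (ha : a ≠ 0) (hb : b ≠ 0) {p q : K} (hp : p ≠ 0) (hq : q ≠ 0)
    {u v u' v' : ℍ[K,a,b]} (hu : u * u = p • 1) (hv : v * v = q • 1) (huv : u * v = -(v * u))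
    (hu' : u' * u' = p • 1) (hv' : v' * v' = q • 1) (huv' : u' * v' = -(v' * u')) :
    ∃ T : ℍ[K,a,b], T ≠ 0 ∧ u * T = T * u' ∧ v * T = T * v' := by
  have re_eq_zero : ∀ {r : K} {x y : ℍ[K,a,b]}, r ≠ 0 → y * y = r • 1 → x * y = -(y * x) →
      x.re = 0 := by
    intro r x y hr hy hxy
    have h1 : (x * y * y).re = r * x.re := by rw [mul_assoc, hy]; simp
    have h2 : (x * y * y).re = -(r * x.re) := by
      rw [re_mul_comm, hxy, mul_neg, ← mul_assoc, hy]; simp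
    have h3 : 2 * (r * x.re) = 0 := by linear_combination h2 - h1
    simpa [hr] using h3
  have ru : u'.re = 0 := re_eq_zero hq hv' huv'
  have rv : v'.re = 0 := re_eq_zero hp hu' (by rw [huv', neg_neg])
  have ruv : (u' * v').re = 0 := re_eq_zero hp hu' <| by
    rw [mul_assoc, ← mul_neg, huv', neg_neg]
  obtain ⟨X, hX⟩ : ∃ X, intertwiner p q u v u' v' X ≠ 0 := by
    by_contra! hc
    have e0 := sum_conj_basis (1 : ℍ[K,a,b])
    simp only [mul_one] at e0
    have h := sum_intertwiner_mul a b p q u v u' v' (⟨0, 1, 0, 0⟩ : ℍ[K,a,b])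
      ⟨0, 0, 1, 0⟩ ⟨0, 0, 0, 1⟩
    rw [sum_conj_basis, sum_conj_basis, sum_conj_basis, e0, ru, rv, ruv] at h
    simp only [hc, zero_mul, smul_zero, add_zero, sub_zero, mul_zero, zero_smul, re_one] at h
    have := congrArg re h
    simp [ha, hb, hp, hq] at this
  exact ⟨_, hX, mul_intertwiner hu hv huv hu' hv' huv' X⟩

theorem isUnit_of_forall_exists_mul_eq (hK : IsField K) (ha : a ≠ 0) (hb : b ≠ 0)
    {T : ℍ[K,a,b]} (hT : T ≠ 0)
    (h : ∀ A, ∃ B, A * T = T * B) : IsUnit T := by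
  have h1 := star_mul_eq_coe T
  have h2 := mul_star_eq_coe T
  set n := (star T * T).re with hn
  rw [re_mul_comm T, ← hn] at h2
  have hn0 : n ≠ 0 := by
    intro h0
    rw [h0, coe_zero] at h1
    have : star T = 0 ∨ T = 0 := by
      refine eq_zero_or_eq_zero_of_forall_mul_mul_eq_zero ha hb fun z => ?_
      obtain ⟨B, hB⟩ := h z
      rw [mul_assoc, hB, ← mul_assoc, h1, zero_mul]
    simp [hT] at this
  obtain ⟨m, hm⟩ := hK.mul_inv_cancel hn0
  refine ⟨⟨T, m • star T, ?_, ?_⟩, rfl⟩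
  · rw [mul_smul_comm, h2, ← coe_mul_eq_smul, ← coe_mul, mul_comm m, hm, coe_one]
  · rw [smul_mul_assoc, h1, ← coe_mul_eq_smul, ← coe_mul, mul_comm m, hm, coe_one]

end CommRing

end QuaternionAlgebra

theorem fact_irreducible_X_sq_add_C {d : ℕ} (hd : 1 ≤ d) :
    Fact (Irreducible ((Polynomial.X : ℚ[X]) ^ 2 + Polynomial.C (d : ℚ))) := by
  have hdeg : ((Polynomial.X : ℚ[X]) ^ 2 + Polynomial.C (d : ℚ)).natDegree = 2 :=
    Polynomial.natDegree_X_pow_add_C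
  refine ⟨Polynomial.irreducible_of_degree_le_three_of_not_isRoot (by rw [hdeg]; decide) ?_⟩
  intro x hx
  have h : x ^ 2 + (d : ℚ) = 0 := by simpa using hx
  have : (1 : ℚ) ≤ d := by exact_mod_cast hd
  nlinarith [sq_nonneg x]

namespace Qk

variable {d : ℕ}

theorem root_mul_root : QkRoot d * QkRoot d = algebraMap ℚ (Qk d) (-d) := by
  have h := AdjoinRoot.eval₂_root ((Polynomial.X : ℚ[X]) ^ 2 + Polynomial.C (d : ℚ))
  simp only [Polynomial.eval₂_add, Polynomial.eval₂_X_pow, Polynomial.eval₂_C] at h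
  rw [map_neg, eq_neg_iff_add_eq_zero, ← sq]
  exact h

theorem exists_eq_add_mul_root_s8 (c : Qk d) :
    ∃ p q : ℚ, c = algebraMap ℚ (Qk d) p + algebraMap ℚ (Qk d) q * QkRoot d := by
  induction c using AdjoinRoot.induction_on with
  | _ f =>
  induction f using Polynomial.induction_on' with
  | add f g hf hg =>
    obtain ⟨p, q, h⟩ := hf
    obtain ⟨p', q', h'⟩ := hg
    exact ⟨p + p', q + q', by rw [map_add, h, h']; simp only [map_add]; ring⟩
  | monomial n r =>
    induction n with
    | zero => exact ⟨r, 0, by rw [map_zero, zero_mul, add_zero]; rfl⟩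
    | succ n ih =>
      obtain ⟨p, q, h⟩ := ih
      refine ⟨-d * q, p, ?_⟩
      rw [← Polynomial.monomial_mul_X, map_mul, h, AdjoinRoot.mk_X]
      have := root_mul_root (d := d)
      rw [map_mul, ← this]
      simp only [QkRoot]
      ring

/-- The nontrivial automorphism of `k = ℚ(i√d)`. -/
noncomputable def conj (d : ℕ) : Qk d →ₐ[ℚ] Qk d :=
  AdjoinRoot.liftAlgHom _ (Algebra.ofId ℚ (Qk d)) (-QkRoot d) (by
    have h := root_mul_root (d := d)
    rw [map_neg, eq_neg_iff_add_eq_zero, ← sq] at h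
    simpa [Algebra.ofId_apply] using h)

theorem conj_root : conj d (QkRoot d) = -QkRoot d :=
  AdjoinRoot.liftAlgHom_root ..

theorem conj_conj (c : Qk d) : conj d (conj d c) = c := by
  obtain ⟨p, q, rfl⟩ := exists_eq_add_mul_root_s8 c
  simp only [map_add, map_mul, AlgHom.commutes, conj_root, map_neg, neg_neg]

theorem root_ne_zero (hd : 1 ≤ d) : QkRoot d ≠ 0 := by
  have := fact_irreducible_X_sq_add_C hd
  intro h
  have h2 := root_mul_root (d := d)
  rw [h, mul_zero, eq_comm, map_eq_zero, neg_eq_zero, Nat.cast_eq_zero] at h2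
  omega

theorem exists_eq_algebraMap_of_conj_eq (hd : 1 ≤ d) {c : Qk d} (h : conj d c = c) :
    ∃ q : ℚ, c = algebraMap ℚ (Qk d) q := by
  have := fact_irreducible_X_sq_add_C hd
  have : CharZero (Qk d) := algebraRat.charZero _
  obtain ⟨p, q, rfl⟩ := exists_eq_add_mul_root_s8 c
  refine ⟨p, ?_⟩
  simp only [map_add, map_mul, AlgHom.commutes, conj_root] at h
  linear_combination (-1 / 2) * h

/-- Hilbert 90 for `k / ℚ`. -/
theorem exists_conj_mul_eq (hd : 1 ≤ d) {c : Qk d} (h : conj d c * c = 1) :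
    ∃ l : Qk d, l ≠ 0 ∧ conj d l * c = l := by
  by_cases hc : 1 + c = 0
  · refine ⟨QkRoot d, root_ne_zero hd, ?_⟩
    rw [conj_root, eq_neg_of_add_eq_zero_right hc]
    ring
  · refine ⟨1 + c, hc, ?_⟩
    rw [map_add, map_one]
    linear_combination h

end Qk

section Semilinear

variable {d : ℕ} {a b : ℚ} {Φ : Mq d a b ≃ₐ[ℚ] Mq d a b}

theorem map_smul_of_map_root
    (hΦroot : Φ (QkRoot d • (1 : Mq d a b)) = -(QkRoot d • (1 : Mq d a b)))
    (c : Qk d) (A : Mq d a b) : Φ (c • A) = Qk.conj d c • Φ A := by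
  have hroot : ∀ B : Mq d a b, Φ (QkRoot d • B) = -(QkRoot d • Φ B) := fun B => by
    rw [← one_mul B, ← smul_mul_assoc, map_mul, hΦroot, one_mul, neg_mul, smul_mul_assoc, one_mul]
  obtain ⟨p, q, rfl⟩ := Qk.exists_eq_add_mul_root_s8 c
  simp only [map_add, map_mul, AlgHom.commutes, Qk.conj_root, add_smul, mul_smul,
    algebraMap_smul, map_smul, hroot, neg_smul]

theorem map_eq_conj_of_map_ratQuat (hΦfix : ∀ A : Mq d a b, IsRatQuat d a b A → Φ A = A)
    (hΦroot : Φ (QkRoot d • (1 : Mq d a b)) = -(QkRoot d • (1 : Mq d a b))) (A : Mq d a b) :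
    Φ A = ⟨Qk.conj d A.re, Qk.conj d A.imI, Qk.conj d A.imJ, Qk.conj d A.imK⟩ := by
  have hA : A = A.re • (⟨1, 0, 0, 0⟩ : Mq d a b) + A.imI • (⟨0, 1, 0, 0⟩ : Mq d a b)
      + A.imJ • (⟨0, 0, 1, 0⟩ : Mq d a b) + A.imK • (⟨0, 0, 0, 1⟩ : Mq d a b) :=
    QuaternionAlgebra.mk_eq_sum_basis A.re A.imI A.imJ A.imK
  have h1 := hΦfix ⟨1, 0, 0, 0⟩ ⟨1, 0, 0, 0, by simp only [map_zero, map_one]⟩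
  have h2 := hΦfix ⟨0, 1, 0, 0⟩ ⟨0, 1, 0, 0, by simp only [map_zero, map_one]⟩
  have h3 := hΦfix ⟨0, 0, 1, 0⟩ ⟨0, 0, 1, 0, by simp only [map_zero, map_one]⟩
  have h4 := hΦfix ⟨0, 0, 0, 1⟩ ⟨0, 0, 0, 1, by simp only [map_zero, map_one]⟩
  conv_lhs => rw [hA]
  simp only [map_add, map_smul_of_map_root hΦroot, h1, h2, h3, h4]
  exact (QuaternionAlgebra.mk_eq_sum_basis ..).symm

theorem map_star_of_map_ratQuat (hΦfix : ∀ A : Mq d a b, IsRatQuat d a b A → Φ A = A)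
    (hΦroot : Φ (QkRoot d • (1 : Mq d a b)) = -(QkRoot d • (1 : Mq d a b))) (A : Mq d a b) :
    Φ (star A) = star (Φ A) := by
  rw [map_eq_conj_of_map_ratQuat hΦfix hΦroot, map_eq_conj_of_map_ratQuat hΦfix hΦroot A]
  refine Eq.trans ?_ (QuaternionAlgebra.star_mk_zero ..).symm
  have h : star A = ⟨A.re, -A.imI, -A.imJ, -A.imK⟩ :=
    QuaternionAlgebra.star_mk_zero A.re A.imI A.imJ A.imK
  simp only [h, map_neg]

theorem map_map_of_map_ratQuat (hΦfix : ∀ A : Mq d a b, IsRatQuat d a b A → Φ A = A)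
    (hΦroot : Φ (QkRoot d • (1 : Mq d a b)) = -(QkRoot d • (1 : Mq d a b))) (A : Mq d a b) :
    Φ (Φ A) = A := by
  rw [map_eq_conj_of_map_ratQuat hΦfix hΦroot, map_eq_conj_of_map_ratQuat hΦfix hΦroot A]
  ext <;> simp [Qk.conj_conj]

theorem exists_eq_add_root_smul {F : Subalgebra ℚ (Mq d a b)}
    (hF : Submodule.span (Qk d) (F : Set (Mq d a b)) = ⊤) (A : Mq d a b) :
    ∃ f ∈ F, ∃ g ∈ F, A = f + QkRoot d • g := by
  have hA : A ∈ Submodule.span (Qk d) (F : Set (Mq d a b)) := hF ▸ Submodule.mem_top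
  induction hA using Submodule.span_induction with
  | mem x hx => exact ⟨x, hx, 0, F.zero_mem, by simp⟩
  | zero => exact ⟨0, F.zero_mem, 0, F.zero_mem, by simp⟩
  | add x y _ _ hx hy =>
    obtain ⟨f, hf, g, hg, rfl⟩ := hx
    obtain ⟨f', hf', g', hg', rfl⟩ := hy
    exact ⟨f + f', F.add_mem hf hf', g + g', F.add_mem hg hg', by rw [smul_add]; abel⟩
  | smul c x _ hx =>
    obtain ⟨f, hf, g, hg, rfl⟩ := hx
    obtain ⟨p, q, rfl⟩ := Qk.exists_eq_add_mul_root_s8 c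
    refine ⟨p • f + (-d * q) • g, F.add_mem (F.smul_mem hf p) (F.smul_mem hg _),
      q • f + p • g, F.add_mem (F.smul_mem hf q) (F.smul_mem hg p), ?_⟩
    rw [← algebraMap_smul (Qk d) p f, ← algebraMap_smul (Qk d) (-d * q) g,
      ← algebraMap_smul (Qk d) q f, ← algebraMap_smul (Qk d) p g, map_mul, ← Qk.root_mul_root]
    module

theorem forall_commute_of_span_eq_top {F : Subalgebra ℚ (Mq d a b)}
    (hF : Submodule.span (Qk d) (F : Set (Mq d a b)) = ⊤) {C : Mq d a b}
    (h : ∀ f ∈ F, C * f = f * C) (A : Mq d a b) : C * A = A * C := by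
  obtain ⟨f, hf, g, hg, rfl⟩ := exists_eq_add_root_smul hF A
  rw [mul_add, add_mul, mul_smul_comm, smul_mul_assoc, h f hf, h g hg]

theorem mem_FET_iff_s8 {T : (Mq d a b)ˣ} {A : Mq d a b} :
    A ∈ FET Φ T ↔ (T : Mq d a b) * Φ A = A * T := by
  change (T : Mq d a b) * Φ A * (↑T⁻¹ : Mq d a b) = A ↔ _
  rw [Units.mul_inv_eq_iff_eq_mul]

theorem FET_eq_of_forall_mul_eq (hd : 1 ≤ d)
    (hΦroot : Φ (QkRoot d • (1 : Mq d a b)) = -(QkRoot d • (1 : Mq d a b)))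
    {F : Subalgebra ℚ (Mq d a b)} (hF : Submodule.span (Qk d) (F : Set (Mq d a b)) = ⊤)
    {T : (Mq d a b)ˣ} (h : ∀ f ∈ F, (T : Mq d a b) * Φ f = f * T) : FET Φ T = F := by
  have := fact_irreducible_X_sq_add_C hd
  have : CharZero (Qk d) := algebraRat.charZero _
  refine le_antisymm (fun A hA => ?_) fun f hf => mem_FET_iff_s8.2 (h f hf)
  obtain ⟨f, hf, g, hg, rfl⟩ := exists_eq_add_root_smul hF A
  rw [mem_FET_iff_s8, map_add, map_smul_of_map_root hΦroot, Qk.conj_root, mul_add, mul_smul_comm,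
    h f hf, h g hg, add_mul, add_right_inj, smul_mul_assoc] at hA
  have h0 : (2 * QkRoot d) • (g * (T : Mq d a b)) = 0 := by
    linear_combination (norm := module) -(1 : Qk d) • hA
  rw [smul_eq_zero_iff_right (mul_ne_zero two_ne_zero (Qk.root_ne_zero hd)),
    Units.mul_left_eq_zero] at h0
  simpa [h0] using hf

theorem exists_unit_forall_mul_eq (hd : 1 ≤ d) (ha : a ≠ 0) (hb : b ≠ 0)
    {F : Subalgebra ℚ (Mq d a b)}
    (hFquat : ∃ a' b' : ℚ, a' ≠ 0 ∧ b' ≠ 0 ∧ Nonempty (ℍ[ℚ, a', b'] ≃ₐ[ℚ] F))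
    (hF : Submodule.span (Qk d) (F : Set (Mq d a b)) = ⊤) :
    ∃ T : (Mq d a b)ˣ, ∀ f ∈ F, (T : Mq d a b) * Φ f = f * T := by
  have := fact_irreducible_X_sq_add_C hd
  have : CharZero (Qk d) := algebraRat.charZero _
  have ha' : algebraMap ℚ (Qk d) a ≠ 0 := by simpa using ha
  have hb' : algebraMap ℚ (Qk d) b ≠ 0 := by simpa using hb
  obtain ⟨p, q, hp, hq, ⟨e⟩⟩ := hFquat
  have hp' : algebraMap ℚ (Qk d) p ≠ 0 := by simpa using hp
  have hq' : algebraMap ℚ (Qk d) q ≠ 0 := by simpa using hq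
  let ι : ℍ[ℚ, p, q] →ₐ[ℚ] Mq d a b := F.val.comp e.toAlgHom
  let ι' : ℍ[ℚ, p, q] →ₐ[ℚ] Mq d a b := Φ.toAlgHom.comp ι
  have hii : (⟨0, 1, 0, 0⟩ : ℍ[ℚ, p, q]) * ⟨0, 1, 0, 0⟩ = p • 1 := by ext <;> simp
  have hjj : (⟨0, 0, 1, 0⟩ : ℍ[ℚ, p, q]) * ⟨0, 0, 1, 0⟩ = q • 1 := by ext <;> simp
  have hij : (⟨0, 1, 0, 0⟩ : ℍ[ℚ, p, q]) * ⟨0, 0, 1, 0⟩ = -(⟨0, 0, 1, 0⟩ * ⟨0, 1, 0, 0⟩) := by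
    ext <;> simp
  have hsq : ∀ (φ : ℍ[ℚ, p, q] →ₐ[ℚ] Mq d a b) {x : ℍ[ℚ, p, q]} {r : ℚ}, x * x = r • 1 →
      φ x * φ x = algebraMap ℚ (Qk d) r • 1 := fun φ x r h => by
    rw [← map_mul, h, map_smul, map_one, algebraMap_smul]
  have hanti : ∀ φ : ℍ[ℚ, p, q] →ₐ[ℚ] Mq d a b,
      φ ⟨0, 1, 0, 0⟩ * φ ⟨0, 0, 1, 0⟩ = -(φ ⟨0, 0, 1, 0⟩ * φ ⟨0, 1, 0, 0⟩) := fun φ => by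
    rw [← map_mul, hij, map_neg, map_mul]
  obtain ⟨T, hT, hu, hv⟩ : ∃ T : Mq d a b, T ≠ 0
      ∧ ι ⟨0, 1, 0, 0⟩ * T = T * ι' ⟨0, 1, 0, 0⟩
      ∧ ι ⟨0, 0, 1, 0⟩ * T = T * ι' ⟨0, 0, 1, 0⟩ := QuaternionAlgebra.exists_intertwiner ha' hb' hp' hq'
    (hsq ι hii) (hsq ι hjj) (hanti ι) (hsq ι' hii) (hsq ι' hjj) (hanti ι')
  have hι : ∀ x, T * ι' x = ι x * T := fun x => by
    have hx : x = x.re • 1 + x.imI • ⟨0, 1, 0, 0⟩ + x.imJ • ⟨0, 0, 1, 0⟩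
        + x.imK • (⟨0, 1, 0, 0⟩ * ⟨0, 0, 1, 0⟩) := by
      ext <;> simp
    have huv : T * (ι' ⟨0, 1, 0, 0⟩ * ι' ⟨0, 0, 1, 0⟩)
        = ι ⟨0, 1, 0, 0⟩ * ι ⟨0, 0, 1, 0⟩ * T := by
      rw [← mul_assoc, ← hu, mul_assoc, ← hv, mul_assoc]
    rw [hx]
    simp only [map_add, map_smul, map_mul, map_one, mul_add, add_mul, mul_smul_comm,
      smul_mul_assoc, huv, hu, hv, mul_one, one_mul]
  have hTF : ∀ f ∈ F, T * Φ f = f * T := fun f hf => by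
    have hf' : ι (e.symm ⟨f, hf⟩) = f := congrArg Subtype.val (e.apply_symm_apply ⟨f, hf⟩)
    have h := hι (e.symm ⟨f, hf⟩)
    rw [hf'] at h
    rw [← h, ← congrArg Φ hf']
    rfl
  have hunit : IsUnit T := by
    refine QuaternionAlgebra.isUnit_of_forall_exists_mul_eq (Field.toIsField _) ha' hb' hT fun A => ?_
    obtain ⟨f, hf, g, hg, rfl⟩ := exists_eq_add_root_smul hF A
    refine ⟨Φ f + QkRoot d • Φ g, ?_⟩
    change (f + QkRoot d • g : Mq d a b) * T = T * (Φ f + QkRoot d • Φ g : Mq d a b)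
    rw [mul_add, add_mul, mul_smul_comm, smul_mul_assoc, hTF f hf, hTF g hg]
  exact ⟨hunit.unit, hTF⟩

end Semilinear

/-- Satz Item06 (iii).  Let `d ∈ ℕ` be squarefree, `k = ℚ(i√d)`,
`E = ℍ[ℚ,a,b]`, `M = k ⊗_ℚ E = ℍ[k,a,b]` and `Φ = Φ_E`.  Every `ℚ`-quaternion
subalgebra `F ⊆ M` with `k·F = M` is of the form `F = F(E,T)` for some `T ∈ M^×` with
`Φ(T) = T*`, and `T` is unique up to a factor in `ℚ^×`. -/
theorem stmt_8 (d : ℕ) (hd : Squarefree d) (hd1 : 1 ≤ d)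
    (a b : ℚ) (ha : a ≠ 0) (hb : b ≠ 0)
    (Φ : Mq d a b ≃ₐ[ℚ] Mq d a b)
    (hΦfix : ∀ A : Mq d a b, IsRatQuat d a b A → Φ A = A)
    (hΦroot : Φ (QkRoot d • (1 : Mq d a b)) = -(QkRoot d • (1 : Mq d a b)))
    (F : Subalgebra ℚ (Mq d a b))
    (hFquat : ∃ a' b' : ℚ, a' ≠ 0 ∧ b' ≠ 0 ∧ Nonempty (ℍ[ℚ, a', b'] ≃ₐ[ℚ] F))
    (hFspan : Submodule.span (Qk d) (F : Set (Mq d a b)) = ⊤) :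
    ∃ T : (Mq d a b)ˣ,
      Φ (T : Mq d a b) = star (T : Mq d a b) ∧ FET Φ T = F ∧
      ∀ T' : (Mq d a b)ˣ, Φ (T' : Mq d a b) = star (T' : Mq d a b) → FET Φ T' = F →
        ∃ q : ℚ, q ≠ 0 ∧ (T' : Mq d a b) = algebraMap ℚ (Mq d a b) q * (T : Mq d a b) := by
  have := fact_irreducible_X_sq_add_C hd1
  have : CharZero (Qk d) := algebraRat.charZero _
  have ha' : algebraMap ℚ (Qk d) a ≠ 0 := by simpa using ha
  have hsmul := map_smul_of_map_root hΦroot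
  have hstar := map_star_of_map_ratQuat hΦfix hΦroot
  have hinv := map_map_of_map_ratQuat hΦfix hΦroot
  have central : ∀ C : Mq d a b, (∀ f ∈ F, C * f = f * C) → ∃ c : Qk d, C = c • 1 :=
    fun C h => ⟨C.re, QuaternionAlgebra.eq_re_smul_one_of_forall_commute ha'
      (forall_commute_of_span_eq_top hFspan h)⟩
  have smul_inj : ∀ (T : (Mq d a b)ˣ) (x y : Qk d), x • (T : Mq d a b) = y • (T : Mq d a b) →
      x = y := fun T x y h => by
    have h1 := congrArg (· * (↑T⁻¹ : Mq d a b)) h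
    simp only [smul_mul_assoc, Units.mul_inv] at h1
    simpa using congrArg QuaternionAlgebra.re h1
  obtain ⟨S, hS⟩ := exists_unit_forall_mul_eq (Φ := Φ) hd1 ha hb hFquat hFspan
  have hS' : ∀ f ∈ F, Φ S * f = Φ f * Φ S := fun f hf => by
    have h := congrArg Φ (hS f hf)
    rwa [map_mul, map_mul, hinv] at h
  obtain ⟨n, hn⟩ := central (S * Φ S) fun f hf => by
    rw [mul_assoc, hS' f hf, ← mul_assoc, hS f hf, mul_assoc]
  -- `S * star S` and `S * Φ S` are both scalar, so `Φ S` and `star S` are proportional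
  obtain ⟨m, hm⟩ : ∃ m : Qk d, (S : Mq d a b) * star (S : Mq d a b) = m • 1 :=
    ⟨_, (QuaternionAlgebra.mul_star_eq_coe _).trans (by
      rw [← QuaternionAlgebra.coe_mul_eq_smul, mul_one])⟩
  have hm0 : m ≠ 0 := by
    rintro rfl
    rw [zero_smul, Units.mul_right_eq_zero, star_eq_zero] at hm
    exact S.ne_zero hm
  have hc : Φ S = (n / m) • star (S : Mq d a b) := by
    rw [← S.isUnit.mul_right_inj, hn, mul_smul_comm, hm, smul_smul, div_mul_cancel₀ _ hm0]
  set c := n / m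
  have hcc : Qk.conj d c * c = 1 := by
    apply smul_inj S
    have h := congrArg Φ hc
    rw [hinv, hsmul, hstar, hc, QuaternionAlgebra.star_smul, star_star, smul_smul] at h
    rw [one_smul, ← h]
  obtain ⟨l, hl, hlc⟩ := Qk.exists_conj_mul_eq hd1 hcc
  let T : (Mq d a b)ˣ := Units.mk0 l hl • S
  have hT : (T : Mq d a b) = l • (S : Mq d a b) := rfl
  have hTF : ∀ f ∈ F, (T : Mq d a b) * Φ f = f * T := fun f hf => by
    rw [hT, smul_mul_assoc, hS f hf, mul_smul_comm]
  have hTstar : Φ T = star (T : Mq d a b) := by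
    rw [hT, hsmul, hc, smul_smul, hlc, QuaternionAlgebra.star_smul]
  refine ⟨T, hTstar, FET_eq_of_forall_mul_eq hd1 hΦroot hFspan hTF, fun T' hT' hFT' => ?_⟩
  obtain ⟨x, hx⟩ := central (T' * (↑T⁻¹ : Mq d a b)) fun f hf => by
    have h1 := mem_FET_iff_s8.1 (hFT' ▸ hf : f ∈ FET Φ T')
    have h2 : (↑T⁻¹ : Mq d a b) * f = Φ f * (↑T⁻¹ : Mq d a b) := by
      rw [Units.inv_mul_eq_iff_eq_mul, ← mul_assoc, hTF f hf, mul_assoc, Units.mul_inv, mul_one]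
    rw [mul_assoc, h2, ← mul_assoc, h1, mul_assoc]
  have hTT' : (T' : Mq d a b) = x • (T : Mq d a b) := by
    rw [Units.mul_inv_eq_iff_eq_mul, smul_mul_assoc, one_mul] at hx
    exact hx
  have hxx : Qk.conj d x = x := by
    rw [hTT', hsmul, hTstar, QuaternionAlgebra.star_smul] at hT'
    have h := congrArg star hT'
    rw [QuaternionAlgebra.star_smul, QuaternionAlgebra.star_smul, star_star] at h
    exact smul_inj T _ _ h
  obtain ⟨r, rfl⟩ := Qk.exists_eq_algebraMap_of_conj_eq hd1 hxx
  refine ⟨r, ?_, ?_⟩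
  · rintro rfl
    rw [map_zero, zero_smul] at hTT'
    exact T'.ne_zero hTT'
  · rw [hTT', algebraMap_smul, Algebra.smul_def]
end

section
/- Let d ∈ ℕ be squarefree, k = ℚ(i√d) with ring of integers 𝔬. The Bianchi group PSL₂(𝔬) contains a subgroup isomorphic to the dihedral group of order 6 (S₃) if and only if every prime divisor p ≠ 3 of d satisfies p ≡ 1 (mod 3). -/
open Matrix
open scoped NumberField MatrixGroups

/-- Rounding in the hexagonal lattice. -/
lemma exists_hexagonal_rounding (m : ℤ) (hm : m ≠ 0) (a b : ℤ) :
    ∃ k l r s : ℤ, a = m * k + r ∧ b = m * l + s ∧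
    16 * (r ^ 2 - r * s + s ^ 2) ≤ 7 * m ^ 2 := by
  have key : ∀ x : ℤ, ∃ l s : ℤ, x = m * l + s ∧ 4 * s ^ 2 ≤ m ^ 2 := by
    intro x
    refine ⟨round ((x : ℚ) / m), x - m * round ((x : ℚ) / m), by ring, ?_⟩
    have h := abs_sub_round ((x : ℚ) / m)
    have hm' : (m : ℚ) ≠ 0 := by exact_mod_cast hm
    have h2 : ((x : ℚ) / m - round ((x : ℚ) / m)) ^ 2 ≤ (1 / 2) ^ 2 :=
      sq_le_sq' (by linarith [neg_abs_le ((x : ℚ) / m - round ((x : ℚ) / m))])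
        (le_trans (le_abs_self _) h)
    have h3 : ((x : ℚ) - m * round ((x : ℚ) / m)) = m * ((x : ℚ) / m - round ((x : ℚ) / m)) := by
      field_simp
    have h4 : (4 : ℚ) * (x - m * round ((x : ℚ) / m)) ^ 2 ≤ (m : ℚ) ^ 2 := by
      rw [h3, mul_pow]
      nlinarith [sq_nonneg (m : ℚ)]
    exact_mod_cast h4
  obtain ⟨l, s, hb, hs⟩ := key b
  -- choose the first remainder `r` with `|2 r - s| ≤ |m|`
  have key2 : ∃ k r : ℤ, a = m * k + r ∧ (2 * r - s) ^ 2 ≤ m ^ 2 := by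
    refine ⟨round (((2 * a - s : ℤ) : ℚ) / (2 * m)),
      a - m * round (((2 * a - s : ℤ) : ℚ) / (2 * m)), by ring, ?_⟩
    set y := ((2 * a - s : ℤ) : ℚ) / (2 * m) with hy
    have h := abs_sub_round y
    have hm' : (m : ℚ) ≠ 0 := by exact_mod_cast hm
    have h2 : (y - round y) ^ 2 ≤ (1 / 2) ^ 2 :=
      sq_le_sq' (by linarith [neg_abs_le (y - round y)]) (le_trans (le_abs_self _) h)
    have h3 : (2 * ((a : ℚ) - m * round y) - s) = 2 * m * (y - round y) := by
      have : 2 * m * y = 2 * a - s := by rw [hy]; push_cast; field_simp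
      linear_combination -this
    have h4 : (2 * ((a : ℚ) - m * round y) - s) ^ 2 ≤ (m : ℚ) ^ 2 := by
      rw [h3, mul_pow]
      nlinarith [sq_nonneg (m : ℚ)]
    exact_mod_cast h4
  obtain ⟨k, r, ha, hr⟩ := key2
  exact ⟨k, l, r, s, ha, hb, by nlinarith⟩

/-- The matrix of the quaternion `y 0 + y 1 ω + (y 2 + y 3 ω) j` acting on the
basis `1, ω, j, ω j`. -/
def quatMatrix (y : Fin 4 → ℤ) : Matrix (Fin 4) (Fin 4) ℤ :=
  !![y 0, y 1, y 2, y 3;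
    -y 1, y 0 - y 1, -y 3, y 2 - y 3;
    y 3 - y 2, y 3, y 0 - y 1, -y 1;
    -y 3, -y 2, y 1, y 0]

/-- The norm of the quaternion `y 0 + y 1 ω + (y 2 + y 3 ω) j`. -/
def quatNorm (y : Fin 4 → ℤ) : ℤ :=
  (y 0 ^ 2 - y 0 * y 1 + y 1 ^ 2) + (y 2 ^ 2 - y 2 * y 3 + y 3 ^ 2)

lemma det_quatMatrix (y : Fin 4 → ℤ) : (quatMatrix y).det = quatNorm y ^ 2 := by
  simp [quatMatrix, quatNorm, det_succ_row_zero, Fin.sum_univ_succ, Fin.succAbove]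
  ring

lemma quatNorm_eq_zero {y : Fin 4 → ℤ} (h : quatNorm y = 0) : y = 0 := by
  unfold quatNorm at h
  have h1 : y 1 = 0 := by nlinarith [sq_nonneg (2 * y 0 - y 1), sq_nonneg (2 * y 2 - y 3), sq_nonneg (y 3)]
  have h3 : y 3 = 0 := by nlinarith [sq_nonneg (2 * y 0 - y 1), sq_nonneg (2 * y 2 - y 3), sq_nonneg (y 1)]
  rw [h1, h3] at h
  have h0 : y 0 = 0 := by
    rw [← sq_eq_zero_iff]; nlinarith [sq_nonneg (y 0), sq_nonneg (y 2)]
  have h2 : y 2 = 0 := by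
    rw [← sq_eq_zero_iff]; nlinarith [sq_nonneg (y 0), sq_nonneg (y 2)]
  ext i; fin_cases i <;> simpa

lemma exists_quat_rounding (m : ℤ) (hm : m ≠ 0) (y : Fin 4 → ℤ) :
    ∃ k r : Fin 4 → ℤ, y = m • k + r ∧ 0 ≤ quatNorm r ∧ quatNorm r < m ^ 2 := by
  obtain ⟨k, l, r, s, h0, h1, h⟩ := exists_hexagonal_rounding m hm (y 0) (y 1)
  obtain ⟨k', l', r', s', h2, h3, h'⟩ := exists_hexagonal_rounding m hm (y 2) (y 3)
  have hm2 : 0 < m ^ 2 := by positivity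
  refine ⟨![k, l, k', l'], ![r, s, r', s'], ?_, ?_, ?_⟩
  · ext i; fin_cases i <;> simp [*]
  · simp only [quatNorm, cons_val]
    nlinarith [sq_nonneg (2 * r - s), sq_nonneg s, sq_nonneg (2 * r' - s'), sq_nonneg s']
  · simp only [quatNorm, cons_val]
    linarith

section
variable {V : Type*} [AddCommGroup V]

/-- The vectors `v, A v, B v, A B v`. -/
def orbitVec (A B : V →ₗ[ℤ] V) (v : V) : Fin 4 → V := ![v, A v, B v, A (B v)]

/-- The coordinates of `v, A v, B v, A B v`. -/
def orbitMatrix (e : V ≃ₗ[ℤ] (Fin 4 → ℤ)) (A B : V →ₗ[ℤ] V) (v : V) :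
    Matrix (Fin 4) (Fin 4) ℤ := of fun i => e (orbitVec A B v i)

/-- The action of the quaternion `y 0 + y 1 ω + (y 2 + y 3 ω) j`, with `ω` and `j` acting as
`A` and `B`. -/
def quatAct (A B : V →ₗ[ℤ] V) (y : Fin 4 → ℤ) (v : V) : V :=
  y 0 • v + y 1 • A v + y 2 • B v + y 3 • A (B v)

lemma apply_quatAct (e : V ≃ₗ[ℤ] (Fin 4 → ℤ)) (A B : V →ₗ[ℤ] V) (y : Fin 4 → ℤ) (v : V) :
    e (quatAct A B y v) = y ᵥ* orbitMatrix e A B v := by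
  ext j
  simp [quatAct, orbitMatrix, orbitVec, vecMul, dotProduct, Fin.sum_univ_succ]
  ring

/-- `A` and `B` generate an action of `ℤ[ω] ⊕ ℤ[ω] j`, with `ω² + ω + 1 = 0` and `j² = -1`. -/
structure IsQuatPair (A B : V →ₗ[ℤ] V) : Prop where
  sq_left (v : V) : A (A v) = -A v - v
  sq_right (v : V) : B (B v) = -v
  anticomm (v : V) : B (A v) = -B v - A (B v)

variable {A B : V →ₗ[ℤ] V}

lemma IsQuatPair.orbitMatrix_quatAct (h : IsQuatPair A B) (e : V ≃ₗ[ℤ] (Fin 4 → ℤ))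
    (y : Fin 4 → ℤ) (v : V) :
    orbitMatrix e A B (quatAct A B y v) = quatMatrix y * orbitMatrix e A B v := by
  ext i j
  fin_cases i <;>
  · simp [orbitMatrix, orbitVec, quatMatrix, quatAct, Matrix.mul_apply, Fin.sum_univ_succ,
      h.sq_left, h.sq_right, h.anticomm]
    try ring

lemma IsQuatPair.det_orbitMatrix_quatAct (h : IsQuatPair A B) (e : V ≃ₗ[ℤ] (Fin 4 → ℤ))
    (y : Fin 4 → ℤ) (v : V) :
    (orbitMatrix e A B (quatAct A B y v)).det = quatNorm y ^ 2 * (orbitMatrix e A B v).det := by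
  rw [h.orbitMatrix_quatAct, det_mul, det_quatMatrix]

lemma IsQuatPair.quatAct_conj (h : IsQuatPair A B) (y : Fin 4 → ℤ) (v : V) :
    quatAct A B ![y 0 - y 1, -y 1, -y 2, -y 3] (quatAct A B y v) = quatNorm y • v := by
  simp only [quatAct, quatNorm, cons_val, map_add, map_zsmul, h.sq_left, h.sq_right, h.anticomm,
    map_neg, map_sub]
  module

lemma IsQuatPair.det_orbitMatrix_ne_zero (h : IsQuatPair A B) (e : V ≃ₗ[ℤ] (Fin 4 → ℤ))
    {v : V} (hv : v ≠ 0) : (orbitMatrix e A B v).det ≠ 0 := by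
  intro hdet
  obtain ⟨y, hy, hy0⟩ := exists_vecMul_eq_zero_iff.mpr hdet
  rw [← apply_quatAct, map_eq_zero_iff e e.injective] at hy0
  have h1 := h.quatAct_conj y v
  have h2 : e (quatNorm y • v) = 0 := by
    rw [← h1, hy0]; simp [quatAct]
  rw [map_zsmul] at h2
  rcases smul_eq_zero.mp h2 with h3 | h3
  · exact hy (quatNorm_eq_zero h3)
  · exact hv ((map_eq_zero_iff e e.injective).mp h3)

/-- A lattice of rank four with an action of `ℤ[ω] ⊕ ℤ[ω] j` is cyclic: this order is Euclidean. -/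
theorem IsQuatPair.exists_isUnit_det (h : IsQuatPair A B) (e : V ≃ₗ[ℤ] (Fin 4 → ℤ)) :
    ∃ v, IsUnit (orbitMatrix e A B v).det := by
  have hne : ∃ n : ℕ, ∃ v : V, v ≠ 0 ∧ (orbitMatrix e A B v).det.natAbs = n := by
    refine ⟨_, e.symm 1, ?_, rfl⟩
    simp
  classical
  obtain ⟨v, hv, hmin⟩ := Nat.find_spec hne
  replace hmin : ∀ w : V, w ≠ 0 → |(orbitMatrix e A B v).det| ≤ |(orbitMatrix e A B w).det| := by
    intro w hw
    have := Nat.find_min' hne ⟨w, hw, rfl⟩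
    rw [← hmin] at this
    rw [Int.abs_eq_natAbs, Int.abs_eq_natAbs]
    exact_mod_cast this
  set P := orbitMatrix e A B v with hP
  have hm : P.det ≠ 0 := h.det_orbitMatrix_ne_zero e hv
  have key : ∀ u : Fin 4 → ℤ, ∃ k : Fin 4 → ℤ, k ᵥ* P = u := by
    intro u
    obtain ⟨k, r, hkr, hr0, hr⟩ := exists_quat_rounding P.det hm (u ᵥ* P.adjugate)
    refine ⟨k, ?_⟩
    have h1 : P.det • (u - k ᵥ* P) = r ᵥ* P := by
      have : (u ᵥ* P.adjugate) ᵥ* P = P.det • u := by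
        rw [vecMul_vecMul, adjugate_mul, vecMul_smul, vecMul_one]
      rw [hkr, add_vecMul, smul_vecMul] at this
      rw [smul_sub, ← this]; abel
    by_contra hne'
    set w := e.symm (u - k ᵥ* P) with hw
    have hw0 : w ≠ 0 := by
      rw [hw, Ne, map_eq_zero_iff _ e.symm.injective, sub_eq_zero]
      exact fun hh => hne' hh.symm
    have h2 : quatAct A B ![P.det, 0, 0, 0] w = quatAct A B r v := by
      apply e.injective
      rw [apply_quatAct e A B r v, ← h1]
      simp [quatAct, hw]
    have h3 := h.det_orbitMatrix_quatAct e ![P.det, 0, 0, 0] w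
    rw [h2, h.det_orbitMatrix_quatAct, ← hP] at h3
    have h4 : quatNorm ![P.det, 0, 0, 0] = P.det ^ 2 := by simp [quatNorm]
    rw [h4] at h3
    have h5 := hmin w hw0
    have h6 : quatNorm r ^ 2 * |P.det| = (P.det ^ 2) ^ 2 * |(orbitMatrix e A B w).det| := by
      rw [← abs_of_nonneg (sq_nonneg (quatNorm r)), ← abs_mul, h3, abs_mul,
        abs_of_nonneg (sq_nonneg (P.det ^ 2))]
    have h7 : quatNorm r ^ 2 < (P.det ^ 2) ^ 2 := by
      exact pow_lt_pow_left₀ hr hr0 two_ne_zero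
    have h8 : 0 < |P.det| := abs_pos.mpr hm
    nlinarith [sq_nonneg (P.det ^ 2)]
  refine ⟨v, ?_⟩
  choose k hk using key
  have : (of fun i => k (Pi.single i 1)) * P = 1 := by
    ext i j
    have := congrFun (hk (Pi.single i 1)) j
    rw [Matrix.one_apply, ← Pi.single_apply, Pi.single_comm, ← this]
    rfl
  have h9 := congrArg det this
  rw [det_mul, det_one] at h9
  exact IsUnit.of_mul_eq_one_right _ h9

end

/-- Writing the rows of `T` as the vectors `(T i 0 + T i 1 θ, T i 2 + T i 3 θ)` with `θ² = -d`,
this is the part of the determinant of the rows `i` and `j` in `ℚ`. -/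
def rePair (d : ℚ) (T : Matrix (Fin 4) (Fin 4) ℚ) (i j : Fin 4) : ℚ :=
  T i 0 * T j 2 - T i 2 * T j 0 - d * (T i 1 * T j 3 - T i 3 * T j 1)

/-- The coefficient of `θ` in the determinant of the rows `i` and `j`, as in `rePair`. -/
def imPair (T : Matrix (Fin 4) (Fin 4) ℚ) (i j : Fin 4) : ℚ :=
  T i 0 * T j 3 - T i 3 * T j 0 + (T i 1 * T j 2 - T i 2 * T j 1)

lemma plucker_re (d : ℚ) (T : Matrix (Fin 4) (Fin 4) ℚ) :
    rePair d T 0 1 * rePair d T 2 3 - rePair d T 0 2 * rePair d T 1 3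
      + rePair d T 0 3 * rePair d T 1 2 =
    d * (imPair T 0 1 * imPair T 2 3 - imPair T 0 2 * imPair T 1 3
      + imPair T 0 3 * imPair T 1 2) := by
  simp only [rePair, imPair]; ring

lemma plucker_im (d : ℚ) (T : Matrix (Fin 4) (Fin 4) ℚ) :
    rePair d T 0 1 * imPair T 2 3 - rePair d T 0 2 * imPair T 1 3
      + rePair d T 0 3 * imPair T 1 2 +
    (imPair T 0 1 * rePair d T 2 3 - imPair T 0 2 * rePair d T 1 3
      + imPair T 0 3 * rePair d T 1 2) = 0 := by
  simp only [rePair, imPair]; ring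

lemma mul_det_eq_imPair (d : ℚ) (T : Matrix (Fin 4) (Fin 4) ℚ) :
    d * T.det = d * (imPair T 0 1 * imPair T 2 3 - imPair T 0 2 * imPair T 1 3
      + imPair T 0 3 * imPair T 1 2) := by
  suffices h : 2 * (d * T.det) = (rePair d T 0 1 * rePair d T 2 3 - rePair d T 0 2 * rePair d T 1 3
      + rePair d T 0 3 * rePair d T 1 2) + d * (imPair T 0 1 * imPair T 2 3 - imPair T 0 2 * imPair T 1 3
      + imPair T 0 3 * imPair T 1 2) by
    linarith [plucker_re d T]
  simp only [rePair, imPair, det_succ_row_zero, Fin.sum_univ_succ]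
  simp [Fin.succAbove]
  ring

/-- An orthogonal pair of vectors of the form `x² + y² + y z + z²` whose values are `δ²` and `d δ²`
exhibits `d` as a rational norm from `ℚ(√-3)`. -/
lemma exists_norm_of_orthogonal {d δ x₀ y₀ z₀ x₁ y₁ z₁ : ℚ} (hδ : δ ≠ 0)
    (h₁ : x₁ ^ 2 + (y₁ ^ 2 + y₁ * z₁ + z₁ ^ 2) = δ ^ 2)
    (h₀ : x₀ ^ 2 + (y₀ ^ 2 + y₀ * z₀ + z₀ ^ 2) = d * δ ^ 2)
    (h : 2 * x₀ * x₁ + (2 * y₀ * y₁ + y₀ * z₁ + z₀ * y₁ + 2 * z₀ * z₁) = 0) :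
    ∃ X Y Z : ℚ, Z ≠ 0 ∧ X ^ 2 + X * Y + Y ^ 2 = d * Z ^ 2 := by
  by_cases hx : δ = x₁
  · have hz : z₁ = 0 := by
      rw [← sq_eq_zero_iff]; subst hx; nlinarith [sq_nonneg (2 * y₁ + z₁), sq_nonneg z₁]
    have hy : y₁ = 0 := by
      rw [← sq_eq_zero_iff]; subst hx hz; linarith
    have hx0 : x₀ = 0 := by
      subst hx hy hz
      simpa [hδ] using h
    exact ⟨y₀, z₀, δ, hδ, by rw [← h₀, hx0]; ring⟩
  · refine ⟨(δ - x₁) * y₀ + x₀ * y₁, (δ - x₁) * z₀ + x₀ * z₁, δ * (δ - x₁),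
      mul_ne_zero hδ (sub_ne_zero.mpr hx), ?_⟩
    linear_combination (δ - x₁) ^ 2 * h₀ + (δ - x₁) * x₀ * h + x₀ ^ 2 * h₁

lemma exists_norm_of_pairs {d δ : ℚ} (hd : 0 < d) (hδ : δ ≠ 0) (T : Matrix (Fin 4) (Fin 4) ℚ)
    (hdet : T.det = δ ^ 2 ∨ T.det = -δ ^ 2)
    (hr12 : rePair d T 1 2 = -rePair d T 0 2 - rePair d T 0 3)
    (hr13 : rePair d T 1 3 = rePair d T 0 2) (hr23 : rePair d T 2 3 = -rePair d T 0 1)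
    (hi12 : imPair T 1 2 = -imPair T 0 2 - imPair T 0 3)
    (hi13 : imPair T 1 3 = imPair T 0 2) (hi23 : imPair T 2 3 = -imPair T 0 1) :
    ∃ X Y Z : ℚ, Z ≠ 0 ∧ X ^ 2 + X * Y + Y ^ 2 = d * Z ^ 2 := by
  have h1 := plucker_re d T
  have h2 := plucker_im d T
  have h3 := mul_left_cancel₀ hd.ne' (mul_det_eq_imPair d T)
  rw [hr12, hr13, hr23, hi12, hi13, hi23] at h1 h2
  rw [hi12, hi13, hi23] at h3
  have hδ2 : 0 < δ ^ 2 := by positivity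
  have h4 : imPair T 0 1 ^ 2 + (imPair T 0 2 ^ 2 + imPair T 0 2 * imPair T 0 3 + imPair T 0 3 ^ 2)
      = δ ^ 2 := by
    rcases hdet with h | h
    · nlinarith [sq_nonneg (imPair T 0 1), sq_nonneg (imPair T 0 3),
        sq_nonneg (2 * imPair T 0 2 + imPair T 0 3)]
    · linarith
  exact exists_norm_of_orthogonal hδ h4 (x₀ := rePair d T 0 1) (y₀ := rePair d T 0 2)
    (z₀ := rePair d T 0 3) (by linear_combination d * h4 - h1) (by linear_combination -h2)

lemma dvd_of_dvd_norm {p : ℕ} (hp : p.Prime) (hp3 : p ≠ 3) (hp1 : p % 3 ≠ 1) {x y : ℤ}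
    (h : (p : ℤ) ∣ x ^ 2 + x * y + y ^ 2) : (p : ℤ) ∣ x ∧ (p : ℤ) ∣ y := by
  have := Fact.mk hp
  have h' : (x : ZMod p) ^ 2 + x * y + (y : ZMod p) ^ 2 = 0 := by
    have := (ZMod.intCast_zmod_eq_zero_iff_dvd _ p).mpr h
    push_cast at this; exact this
  have hy : (y : ZMod p) = 0 := by
    by_contra hy
    set t : ZMod p := x / y with ht
    have ht1 : t ^ 2 + t + 1 = 0 := by
      rw [ht]; field_simp; linear_combination h'
    have ht3 : t ^ 3 = 1 := by linear_combination (t - 1) * ht1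
    have hne : t ≠ 1 := by
      rintro h1
      rw [h1] at ht1
      have h3 : ((3 : ℕ) : ZMod p) = 0 := by push_cast; linear_combination ht1
      rw [ZMod.natCast_eq_zero_iff] at h3
      exact hp3 ((Nat.prime_dvd_prime_iff_eq hp Nat.prime_three).mp h3)
    have ho : orderOf t = 3 := orderOf_eq_prime ht3 hne
    have ht0 : t ≠ 0 := by rintro h0; rw [h0] at ht3; simp at ht3
    have hdvd := orderOf_dvd_of_pow_eq_one (ZMod.pow_card_sub_one_eq_one ht0)
    rw [ho] at hdvd
    have := hp.two_le
    omega
  have hx : (x : ZMod p) = 0 := by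
    rw [hy] at h'; simpa using h'
  exact ⟨(ZMod.intCast_zmod_eq_zero_iff_dvd _ p).mp hx, (ZMod.intCast_zmod_eq_zero_iff_dvd _ p).mp hy⟩

lemma not_norm_of_prime_dvd {d : ℕ} (hd : Squarefree d) {p : ℕ} (hp : p.Prime) (hpd : p ∣ d)
    (hp3 : p ≠ 3) (hp1 : p % 3 ≠ 1) (n : ℕ) : ∀ x y z : ℤ, z.natAbs = n → z ≠ 0 →
    x ^ 2 + x * y + y ^ 2 ≠ d * z ^ 2 := by
  induction n using Nat.strong_induction_on with
  | _ n ih =>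
  rintro x y z hn hz h
  have hpd' : (p : ℤ) ∣ d := by exact_mod_cast hpd
  have hp0 : (p : ℤ) ≠ 0 := by exact_mod_cast hp.ne_zero
  obtain ⟨⟨x', rfl⟩, ⟨y', rfl⟩⟩ := dvd_of_dvd_norm hp hp3 hp1 (h ▸ hpd'.mul_right _)
  obtain ⟨m, rfl⟩ := hpd
  have hpm : ¬ (p : ℤ) ∣ m := by
    intro hh
    have hh' : p ∣ m := by exact_mod_cast hh
    exact hp.one_lt.ne' (Nat.isUnit_iff.mp (hd p (Nat.mul_dvd_mul_left p hh')))
  have h2 : (p : ℤ) * (x' ^ 2 + x' * y' + y' ^ 2) = m * z ^ 2 := by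
    apply mul_left_cancel₀ hp0
    push_cast at h
    linear_combination h
  have hpz : (p : ℤ) ∣ z := by
    have h3 : (p : ℤ) ∣ m * z ^ 2 := ⟨_, h2.symm⟩
    have hpi := Nat.prime_iff_prime_int.mp hp
    exact hpi.dvd_of_dvd_pow ((hpi.dvd_or_dvd h3).resolve_left hpm)
  obtain ⟨z', rfl⟩ := hpz
  have hz' : z' ≠ 0 := right_ne_zero_of_mul hz
  refine ih z'.natAbs ?_ x' y' z' rfl hz' ?_
  · rw [← hn, Int.natAbs_mul, Int.natAbs_natCast]
    have := hp.two_le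
    have := Int.natAbs_pos.mpr hz'
    nlinarith
  · apply mul_left_cancel₀ hp0
    push_cast
    linear_combination h2

lemma prime_mod_three_of_norm {d : ℕ} (hd : Squarefree d) {X Y Z : ℚ} (hZ : Z ≠ 0)
    (h : X ^ 2 + X * Y + Y ^ 2 = d * Z ^ 2) {p : ℕ} (hp : p.Prime) (hpd : p ∣ d) (hp3 : p ≠ 3) :
    p % 3 = 1 := by
  by_contra hp1
  have hX := X.num_div_den
  have hY := Y.num_div_den
  have hZ' := Z.num_div_den
  have hXd : (X.den : ℚ) ≠ 0 := by exact_mod_cast X.den_ne_zero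
  have hYd : (Y.den : ℚ) ≠ 0 := by exact_mod_cast Y.den_ne_zero
  have hZd : (Z.den : ℚ) ≠ 0 := by exact_mod_cast Z.den_ne_zero
  refine not_norm_of_prime_dvd hd hp hpd hp3 hp1 _ (X.num * Y.den * Z.den) (Y.num * X.den * Z.den)
    (Z.num * X.den * Y.den) rfl ?_ ?_
  · simp [hZ]
  · have hX' : (X.num : ℚ) = X * X.den := (Rat.mul_den_eq_num X).symm
    have hY' : (Y.num : ℚ) = Y * Y.den := (Rat.mul_den_eq_num Y).symm
    have hZ'' : (Z.num : ℚ) = Z * Z.den := (Rat.mul_den_eq_num Z).symm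
    have : ((X.num * Y.den * Z.den) ^ 2 + (X.num * Y.den * Z.den) * (Y.num * X.den * Z.den)
      + (Y.num * X.den * Z.den) ^ 2 : ℚ) = d * (Z.num * X.den * Y.den) ^ 2 := by
      rw [hX', hY', hZ'']
      linear_combination (X.den * Y.den * Z.den : ℚ) ^ 2 * h
    exact_mod_cast this

/-- Three relations on a group element of order three and an involution yield a copy of
the dihedral group of order six. -/
lemma exists_subgroup_mulEquiv_dihedralGroup {G : Type*} [Group G] {ρ σ : G} (hρ : ρ ^ 3 = 1)
    (hρ1 : ρ ≠ 1) (hσ : σ ^ 2 = 1) (hρσ : (ρ * σ) ^ 2 = 1) :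
    ∃ H : Subgroup G, Nonempty (H ≃* DihedralGroup 3) := by
  have hconj : σ * ρ * σ⁻¹ = ρ⁻¹ := by
    have h1 : σ⁻¹ = σ := inv_eq_of_mul_eq_one_right (by rw [← sq, hσ])
    rw [h1, eq_inv_iff_mul_eq_one]
    have h2 : ρ * (σ * ρ * σ) = 1 := by rw [sq] at hρσ; simpa [mul_assoc] using hρσ
    exact mul_eq_one_comm.mp h2
  let h : ZMod 3 →+ Additive G := ZMod.lift 3 ⟨zmultiplesHom _ (Additive.ofMul ρ), by
    change ((3 : ℕ) : ℤ) • Additive.ofMul ρ = 0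
    rw [natCast_zsmul, ← ofMul_pow, hρ, ofMul_one]⟩
  let g : ZMod 3 → G := fun i => (h i).toMul
  have gadd : ∀ i j, g (i + j) = g i * g j := fun i j => by simp [g]
  have gneg : ∀ i, g (-i) = (g i)⁻¹ := fun i => by simp [g]
  have gint : ∀ k : ℤ, g k = ρ ^ k := fun k => by simp [g, h]
  have gcomm : ∀ i, g i * σ = σ * g (-i) := by
    intro i
    obtain ⟨k, rfl⟩ := ZMod.intCast_surjective i
    rw [gneg, gint]
    have h3 : (σ * ρ * σ⁻¹) ^ k = (ρ ^ k)⁻¹ := by rw [hconj, _root_.inv_zpow]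
    rw [conj_zpow] at h3
    have h4 : ρ ^ k = (σ * ρ ^ k * σ⁻¹)⁻¹ := by rw [h3, inv_inv]
    nth_rewrite 1 [h4]
    group
  have hσ' : σ * σ = 1 := by rw [← sq, hσ]
  let f : DihedralGroup 3 →* G := MonoidHom.mk' (fun x => match x with
    | .r i => g i
    | .sr i => σ * g i) (by
      rintro (i | i) (j | j)
      · exact gadd i j
      · simp only [DihedralGroup.r_mul_sr]
        rw [← mul_assoc, gcomm, mul_assoc, ← gadd]; congr 2; ring
      · simp only [DihedralGroup.sr_mul_r, gadd, mul_assoc]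
      · simp only [DihedralGroup.sr_mul_sr]
        rw [mul_assoc, ← mul_assoc (g i), gcomm, mul_assoc, ← mul_assoc, hσ', one_mul, ← gadd]
        congr 1; ring)
  have ginj : ∀ i, g i = 1 → i = 0 := by
    have g1 : g 1 = ρ := by simpa using gint 1
    intro i hi
    fin_cases i
    · rfl
    · exact absurd (g1 ▸ hi) hρ1
    · exfalso
      have h2 : g (-1) = 1 := hi
      rw [gneg, g1, inv_eq_one] at h2
      exact hρ1 h2
  have hf : Function.Injective f := by
    rw [injective_iff_map_eq_one]
    rintro (i | i) hi
    · change g i = 1 at hi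
      rw [ginj i hi]; rfl
    · exfalso
      change σ * g i = 1 at hi
      have h1 : σ = g (-i) := by rw [gneg]; exact eq_inv_of_mul_eq_one_left hi
      have h2 : g (-i + -i) = 1 := by rw [gadd, ← h1, hσ']
      have h3 := ginj _ h2
      have h4 : i = 0 := by revert h3; clear * -; revert i; decide
      rw [h4] at h1
      have h5 : σ = 1 := by rw [h1]; simp [g]
      rw [h5] at hconj
      have h6 : ρ = ρ⁻¹ := by simpa using hconj
      have h7 : ρ ^ 2 = 1 := by rw [sq]; nth_rewrite 2 [h6]; simp
      exact hρ1 (by rw [pow_succ, h7, one_mul] at hρ; exact hρ)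
  exact ⟨f.range, ⟨(MonoidHom.ofInjective hf).symm⟩⟩

section
variable {R : Type*} [CommRing R]

lemma mem_center_iff_entries {g : SL(2, R)} :
    g ∈ Subgroup.center SL(2, R) ↔ g 0 1 = 0 ∧ g 1 0 = 0 ∧ g 0 0 = g 1 1 := by
  rw [Matrix.SpecialLinearGroup.mem_center_iff]
  constructor
  · rintro ⟨r, -, h⟩
    rw [← h]
    simp
  · rintro ⟨h1, h2, h3⟩
    refine ⟨g 0 0, ?_, ?_⟩
    · have := g.det_coe
      rw [det_fin_two, h1, ← h3] at this
      simp only [Fintype.card_fin]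
      linear_combination this
    · ext i j
      fin_cases i <;> fin_cases j <;> simp [h1, h2, h3]

/-- Matrices `!![p, q; r, -1 - p]` and `!![a, b; c, -a]` of determinant one whose product is
traceless generate a dihedral group of order six in `PSL(2, R)`. -/
lemma exists_dihedral_of_entries {p q r a b c : R} (hq : q ≠ 0) (hA : p * (-1 - p) - q * r = 1)
    (hB : -a ^ 2 - b * c = 1) (hAB : p * a + q * c + r * b + (1 + p) * a = 0) :
    ∃ H : Subgroup (Matrix.ProjectiveSpecialLinearGroup (Fin 2) R),
      Nonempty (H ≃* DihedralGroup 3) := by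
  obtain ⟨A, hA0⟩ : ∃ A : SL(2, R), (A : Matrix (Fin 2) (Fin 2) R) = !![p, q; r, -1 - p] :=
    ⟨⟨!![p, q; r, -1 - p], by rw [det_fin_two_of, hA]⟩, rfl⟩
  obtain ⟨B, hB0⟩ : ∃ B : SL(2, R), (B : Matrix (Fin 2) (Fin 2) R) = !![a, b; c, -a] :=
    ⟨⟨!![a, b; c, -a], by rw [det_fin_two_of]; linear_combination hB⟩, rfl⟩
  have hmk (g : SL(2, R)) : (g : Matrix.ProjectiveSpecialLinearGroup (Fin 2) R) = 1 ↔
      g 0 1 = 0 ∧ g 1 0 = 0 ∧ g 0 0 = g 1 1 :=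
    (QuotientGroup.eq_one_iff _).trans mem_center_iff_entries
  apply exists_subgroup_mulEquiv_dihedralGroup
    (ρ := (A : Matrix.ProjectiveSpecialLinearGroup (Fin 2) R))
    (σ := (B : Matrix.ProjectiveSpecialLinearGroup (Fin 2) R))
  · rw [← QuotientGroup.mk_pow, hmk]
    simp only [pow_succ, pow_zero, one_mul, Matrix.SpecialLinearGroup.coe_mul, Matrix.mul_apply,
      Fin.sum_univ_two, hA0]
    simp
    refine ⟨?_, ?_, ?_⟩
    · linear_combination (-q) * hA
    · linear_combination (-r) * hA
    · linear_combination (-(2 * p + 1)) * hA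
  · rw [Ne, hmk]
    exact fun h => hq (by simpa [hA0] using h.1)
  · rw [← QuotientGroup.mk_pow, hmk]
    simp only [sq, Matrix.SpecialLinearGroup.coe_mul, Matrix.mul_apply, Fin.sum_univ_two, hB0]
    simp
    exact ⟨by ring, by ring, by ring⟩
  · rw [← QuotientGroup.mk_mul, ← QuotientGroup.mk_pow, hmk]
    simp only [sq, Matrix.SpecialLinearGroup.coe_mul, Matrix.mul_apply, Fin.sum_univ_two,
      hA0, hB0]
    simp
    refine ⟨?_, ?_, ?_⟩
    · linear_combination (p * b - q * a) * hAB
    · linear_combination (r * a + (-1 - p) * c) * hAB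
    · linear_combination (p * a + q * c - r * b + (-1 - p) * a) * hAB

variable [IsDomain R]

lemma trace_eq_zero_of_sq_mem_center {g : SL(2, R)} (h : g ∉ Subgroup.center SL(2, R))
    (h2 : g ^ 2 ∈ Subgroup.center SL(2, R)) : g 0 0 + g 1 1 = 0 := by
  by_contra ht
  apply h
  rw [mem_center_iff_entries] at h2 ⊢
  simp only [sq, Matrix.SpecialLinearGroup.coe_mul, Matrix.mul_apply, Fin.sum_univ_two] at h2
  obtain ⟨h3, h4, h5⟩ := h2
  refine ⟨?_, ?_, ?_⟩
  · exact (mul_eq_zero.mp (by linear_combination h3 : (g 0 0 + g 1 1) * g 0 1 = 0)).resolve_left ht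
  · exact (mul_eq_zero.mp (by linear_combination h4 : (g 0 0 + g 1 1) * g 1 0 = 0)).resolve_left ht
  · rw [← sub_eq_zero]
    exact (mul_eq_zero.mp (by linear_combination h5 :
      (g 0 0 + g 1 1) * (g 0 0 - g 1 1) = 0)).resolve_left ht

lemma trace_sq_eq_one_of_cube_mem_center {g : SL(2, R)} (h : g ∉ Subgroup.center SL(2, R))
    (h3 : g ^ 3 ∈ Subgroup.center SL(2, R)) : (g 0 0 + g 1 1) ^ 2 = 1 := by
  rw [← sub_eq_zero]
  by_contra ht
  apply h
  have hdet := g.det_coe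
  rw [det_fin_two] at hdet
  rw [mem_center_iff_entries] at h3 ⊢
  simp only [pow_succ, pow_zero, one_mul, Matrix.SpecialLinearGroup.coe_mul, Matrix.mul_apply,
    Fin.sum_univ_two] at h3
  obtain ⟨h4, h5, h6⟩ := h3
  refine ⟨?_, ?_, ?_⟩
  · exact (mul_eq_zero.mp (by linear_combination h4 + g 0 1 * hdet :
      ((g 0 0 + g 1 1) ^ 2 - 1) * g 0 1 = 0)).resolve_left ht
  · exact (mul_eq_zero.mp (by linear_combination h5 + g 1 0 * hdet :
      ((g 0 0 + g 1 1) ^ 2 - 1) * g 1 0 = 0)).resolve_left ht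
  · rw [← sub_eq_zero]
    exact (mul_eq_zero.mp (by linear_combination h6 + (g 0 0 - g 1 1) * hdet :
      ((g 0 0 + g 1 1) ^ 2 - 1) * (g 0 0 - g 1 1) = 0)).resolve_left ht

/-- A dihedral subgroup of order six of `PSL(2, R)` lifts to a pair of matrices
`!![p, q; r, -1 - p]` and `!![a, b; c, -a]` of determinant one whose product is traceless. -/
lemma exists_entries_of_dihedral
    (H : Subgroup (Matrix.ProjectiveSpecialLinearGroup (Fin 2) R)) (φ : H ≃* DihedralGroup 3) :
    ∃ p q r a b c : R, p * (-1 - p) - q * r = 1 ∧ -a ^ 2 - b * c = 1 ∧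
      p * a + q * c + r * b + (1 + p) * a = 0 := by
  have hmk : ∀ x : DihedralGroup 3, ∃ g : SL(2, R),
      (g : Matrix.ProjectiveSpecialLinearGroup (Fin 2) R) = φ.symm x :=
    fun x => QuotientGroup.mk_surjective _
  obtain ⟨A, hA⟩ := hmk (.r 1)
  obtain ⟨B, hB⟩ := hmk (.sr 0)
  have key : ∀ (g : SL(2, R)) (x : DihedralGroup 3),
      (g : Matrix.ProjectiveSpecialLinearGroup (Fin 2) R) = φ.symm x → ∀ n : ℕ,
      (g ^ n ∈ Subgroup.center SL(2, R) ↔ x ^ n = 1) := by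
    intro g x hg n
    have hc : g ^ n ∈ Subgroup.center SL(2, R) ↔
        ((g ^ n : SL(2, R)) : Matrix.ProjectiveSpecialLinearGroup (Fin 2) R) = 1 :=
      (QuotientGroup.eq_one_iff _).symm
    rw [hc, QuotientGroup.mk_pow, hg, ← Subgroup.coe_pow, ← map_pow, OneMemClass.coe_eq_one,
      map_eq_one_iff _ φ.symm.injective]
  have hAB : ((A * B : SL(2, R)) : Matrix.ProjectiveSpecialLinearGroup (Fin 2) R)
      = φ.symm (.r 1 * .sr 0) := by
    rw [QuotientGroup.mk_mul, hA, hB, map_mul, Subgroup.coe_mul]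
  have tA := trace_sq_eq_one_of_cube_mem_center
    (mt (fun h => (key A _ hA 1).mp (by simpa using h)) (by decide)) ((key A _ hA 3).mpr (by decide))
  have tB := trace_eq_zero_of_sq_mem_center
    (mt (fun h => (key B _ hB 1).mp (by simpa using h)) (by decide)) ((key B _ hB 2).mpr (by decide))
  have tAB := trace_eq_zero_of_sq_mem_center
    (mt (fun h => (key (A * B) _ hAB 1).mp (by simpa using h)) (by decide))
    ((key (A * B) _ hAB 2).mpr (by decide))
  have dA := A.det_coe
  have dB := B.det_coe
  rw [det_fin_two] at dA dB
  simp only [Matrix.SpecialLinearGroup.coe_mul, Matrix.mul_apply, Fin.sum_univ_two] at tAB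
  have hB1 : B 1 1 = -B 0 0 := by linear_combination tB
  rw [hB1] at dB tAB
  rcases mul_self_eq_one_iff.mp ((sq _).symm.trans tA) with t | t
  · have hA1 : A 1 1 = 1 - A 0 0 := by linear_combination t
    rw [hA1] at dA tAB
    exact ⟨-A 0 0, -A 0 1, -A 1 0, B 0 0, B 0 1, B 1 0, by linear_combination dA,
      by linear_combination dB, by linear_combination -tAB⟩
  · have hA1 : A 1 1 = -1 - A 0 0 := by linear_combination t
    rw [hA1] at dA tAB
    exact ⟨A 0 0, A 0 1, A 1 0, B 0 0, B 0 1, B 1 0, by linear_combination dA,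
      by linear_combination dB, by linear_combination tAB⟩

end

/-- A positive binary form of discriminant `-3` represents `1`. -/
lemma exists_represents_one (m : ℕ) : ∀ n w : ℤ, 0 < m → (m : ℤ) * n = w ^ 2 + w + 1 →
    ∃ a b : ℤ, m * a ^ 2 + (2 * w + 1) * a * b + n * b ^ 2 = 1 := by
  induction m using Nat.strong_induction_on with
  | _ m ih =>
  intro n w hm h
  rcases Nat.lt_or_ge 1 m with h1 | h1
  · have hm0 : (0 : ℤ) < m := by exact_mod_cast hm
    have hm1 : (2 : ℤ) ≤ m := by exact_mod_cast h1
    -- replace `w` by a representative `v` modulo `m` with `|2 v + 1| ≤ m`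
    obtain ⟨k, v, hv, hv1, hv2⟩ : ∃ k v : ℤ, w = v + m * k ∧ -m ≤ 2 * v + 1 ∧ 2 * v + 1 ≤ m := by
      refine ⟨(w + m / 2) / m, (w + m / 2) % m - m / 2, ?_, ?_, ?_⟩
      · linarith [Int.emod_add_mul_ediv (w + m / 2) m]
      · have := Int.emod_nonneg (w + m / 2) hm0.ne'
        omega
      · have := Int.emod_lt_of_pos (w + m / 2) hm0
        omega
    set l := n - (2 * v + 1) * k - m * k ^ 2 with hl
    have hml : (m : ℤ) * l = v ^ 2 + v + 1 := by
      rw [hl]; rw [hv] at h; linear_combination h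
    have hl0 : 0 < l := by nlinarith [sq_nonneg (2 * v + 1)]
    have hlm : l < m := by nlinarith
    obtain ⟨l', hl'⟩ := Int.eq_ofNat_of_zero_le hl0.le
    rw [hl'] at hml hl0 hlm
    obtain ⟨a, b, hab⟩ := ih l' (by exact_mod_cast hlm) m v (by exact_mod_cast hl0)
      (by linarith)
    refine ⟨b - k * a, a, ?_⟩
    have hn : n = l' + (2 * v + 1) * k + m * k ^ 2 := by rw [← hl', hl]; ring
    rw [hn, hv]
    linear_combination hab
  · obtain rfl : m = 1 := by omega
    exact ⟨1, 0, by simp⟩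

lemma exists_dvd_sq_add_add_one {d : ℕ} (hd : Squarefree d)
    (h : ∀ p : ℕ, p.Prime → p ∣ d → p ≠ 3 → p % 3 = 1) : ∃ w : ℤ, (d : ℤ) ∣ w ^ 2 + w + 1 := by
  induction d using Nat.recOnMul with
  | zero => exact absurd hd not_squarefree_zero
  | one => exact ⟨0, by simp⟩
  | prime p hp =>
    by_cases hp3 : p = 3
    · exact ⟨1, by simp [hp3]⟩
    · have := Fact.mk hp
      have hp1 := h p hp dvd_rfl hp3
      have hp2 := hp.two_le
      have hcard : Fintype.card (ZMod p)ˣ = p - 1 := ZMod.card_units p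
      have := Fact.mk Nat.prime_three
      obtain ⟨t, ht⟩ := exists_prime_orderOf_dvd_card (G := (ZMod p)ˣ) 3 (by rw [hcard]; omega)
      obtain ⟨w, hw⟩ := ZMod.intCast_surjective (t : ZMod p)
      refine ⟨w, (ZMod.intCast_zmod_eq_zero_iff_dvd _ p).mp ?_⟩
      push_cast
      rw [hw]
      have h3 : (t : ZMod p) ^ 3 = 1 := by
        rw [← Units.val_pow_eq_pow_val, ← ht, pow_orderOf_eq_one, Units.val_one]
      have h1 : (t : ZMod p) - 1 ≠ 0 := by
        intro h1
        rw [sub_eq_zero, Units.val_eq_one] at h1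
        rw [h1, orderOf_one] at ht
        omega
      exact (mul_eq_zero.mp (by linear_combination h3 :
        ((t : ZMod p) - 1) * ((t : ZMod p) ^ 2 + t + 1) = 0)).resolve_left h1
  | mul m n hm hn =>
    have hc : IsCoprime (m : ℤ) n := Nat.isCoprime_iff_coprime.mpr (Nat.squarefree_mul_iff.mp hd).1
    obtain ⟨x, hx⟩ := hm (hd.squarefree_of_dvd (dvd_mul_right m n))
      fun p hp hpm => h p hp (hpm.mul_right n)
    obtain ⟨y, hy⟩ := hn (hd.squarefree_of_dvd (dvd_mul_left n m))
      fun p hp hpn => h p hp (hpn.mul_left m)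
    obtain ⟨s, t, hst⟩ := hc
    have hw : ∀ k z w : ℤ, k ∣ z ^ 2 + z + 1 → k ∣ w - z → k ∣ w ^ 2 + w + 1 := by
      rintro k z w h1 h2
      have h3 : w ^ 2 + w + 1 = (z ^ 2 + z + 1) + (w - z) * (w + z + 1) := by ring
      rw [h3]
      exact dvd_add h1 (h2.mul_right _)
    refine ⟨x * t * n + y * s * m, ?_⟩
    push_cast
    refine IsCoprime.mul_dvd ⟨s, t, hst⟩ (hw _ x _ hx ⟨(y - x) * s, ?_⟩)
      (hw _ y _ hy ⟨(x - y) * t, ?_⟩)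
    · linear_combination x * hst
    · linear_combination y * hst

section
variable {K : Type*} [Field K] [CharZero K] {d : ℕ} {θ : K}

lemma eq_zero_of_add_mul_eq_zero (hd : 0 < d) (hθ : θ ^ 2 = -(d : K)) {x y : ℚ}
    (h : (x : K) + y * θ = 0) : x = 0 ∧ y = 0 := by
  have h1 : ((x ^ 2 + d * y ^ 2 : ℚ) : K) = 0 := by
    push_cast
    linear_combination (x - y * θ) * h + (y : K) ^ 2 * hθ
  have h2 : x ^ 2 + d * y ^ 2 = 0 := by exact_mod_cast h1
  have hd' : (0 : ℚ) < d := by exact_mod_cast hd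
  have hx : x = 0 := by
    rw [← sq_eq_zero_iff]
    nlinarith [sq_nonneg x, mul_nonneg hd'.le (sq_nonneg y)]
  refine ⟨hx, ?_⟩
  rw [hx] at h2
  simpa [hd'.ne'] using h2

lemma add_mul_inj (hd : 0 < d) (hθ : θ ^ 2 = -(d : K)) {x y x' y' : ℚ}
    (h : (x : K) + y * θ = x' + y' * θ) : x = x' ∧ y = y' := by
  have := eq_zero_of_add_mul_eq_zero hd hθ (x := x - x') (y := y - y')
    (by push_cast; linear_combination h)
  exact ⟨sub_eq_zero.mp this.1, sub_eq_zero.mp this.2⟩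

lemma exists_eq_add_mul (hd : 0 < d) (hθ : θ ^ 2 = -(d : K)) (hrk : Module.finrank ℚ K = 2)
    (z : K) : ∃ x y : ℚ, z = x + y * θ := by
  have hli : LinearIndependent ℚ ![(1 : K), θ] := by
    rw [LinearIndependent.pair_iff]
    intro s t h
    exact eq_zero_of_add_mul_eq_zero hd hθ (by simpa [Algebra.smul_def] using h)
  have : FiniteDimensional ℚ K := Module.finite_of_finrank_pos (by omega)
  have hs := hli.span_eq_top_of_card_eq_finrank' (by simp [hrk])
  have hz : z ∈ Submodule.span ℚ (Set.range ![(1 : K), θ]) := hs ▸ Submodule.mem_top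
  simp only [Matrix.range_cons, Matrix.range_empty, Set.union_empty, Set.singleton_union] at hz
  obtain ⟨x, y, h⟩ := Submodule.mem_span_pair.mp hz
  exact ⟨x, y, by simpa [Algebra.smul_def] using h.symm⟩
end

/-- The coordinates of a pair of elements of a ring free of rank two over `ℤ`. -/
noncomputable def pairCoord {R : Type*} [CommRing R] (β : Module.Basis (Fin 2) ℤ R) :
    (Fin 2 → R) ≃ₗ[ℤ] (Fin 4 → ℤ) where
  toFun v := ![β.repr (v 0) 0, β.repr (v 0) 1, β.repr (v 1) 0, β.repr (v 1) 1]
  invFun c := ![c 0 • β 0 + c 1 • β 1, c 2 • β 0 + c 3 • β 1]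
  map_add' v w := by ext i; fin_cases i <;> simp
  map_smul' k v := by ext i; fin_cases i <;> simp [-zsmul_eq_mul]
  left_inv v := by
    ext i
    fin_cases i
    · simpa [Fin.sum_univ_two] using β.sum_repr (v 0)
    · simpa [Fin.sum_univ_two] using β.sum_repr (v 1)
  right_inv c := by ext i; fin_cases i <;> simp [-zsmul_eq_mul]

section
variable {R : Type*} [CommRing R] {p q r a b c : R}

/-- Multiplication by a matrix, as a `ℤ`-linear map. -/
def mulVecInt (M : Matrix (Fin 2) (Fin 2) R) : (Fin 2 → R) →ₗ[ℤ] (Fin 2 → R) :=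
  M.mulVecLin.restrictScalars ℤ

lemma mulVecInt_apply (x y z w : R) (v : Fin 2 → R) :
    mulVecInt !![x, y; z, w] v = ![x * v 0 + y * v 1, z * v 0 + w * v 1] := by
  ext i
  fin_cases i <;> simp [mulVecInt, mulVec, dotProduct, Fin.sum_univ_two]

lemma isQuatPair_mulVecInt (hA : p * (-1 - p) - q * r = 1) (hB : -a ^ 2 - b * c = 1)
    (hAB : p * a + q * c + r * b + (1 + p) * a = 0) :
    IsQuatPair (mulVecInt !![p, q; r, -1 - p]) (mulVecInt !![a, b; c, -a]) where
  sq_left v := by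
    simp only [mulVecInt_apply, cons_val]
    ext i
    fin_cases i
    · simp; linear_combination -v 0 * hA
    · simp; linear_combination -v 1 * hA
  sq_right v := by
    simp only [mulVecInt_apply, cons_val]
    ext i
    fin_cases i
    · simp; linear_combination -v 0 * hB
    · simp; linear_combination -v 1 * hB
  anticomm v := by
    simp only [mulVecInt_apply, cons_val]
    ext i
    fin_cases i
    · simp; linear_combination v 0 * hAB
    · simp; linear_combination v 1 * hAB

/-- The determinant of two vectors of the orbit. -/
def orbitPair (A B : (Fin 2 → R) →ₗ[ℤ] (Fin 2 → R)) (v : Fin 2 → R) (i j : Fin 4) : R :=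
  orbitVec A B v i 0 * orbitVec A B v j 1 - orbitVec A B v i 1 * orbitVec A B v j 0

lemma orbitPair_relations (hA : p * (-1 - p) - q * r = 1) (hB : -a ^ 2 - b * c = 1)
    (hAB : p * a + q * c + r * b + (1 + p) * a = 0) (v : Fin 2 → R) :
    let M := orbitPair (mulVecInt !![p, q; r, -1 - p]) (mulVecInt !![a, b; c, -a]) v
    M 1 2 = -M 0 2 - M 0 3 ∧ M 1 3 = M 0 2 ∧ M 2 3 = -M 0 1 := by
  simp only [orbitPair, orbitVec, mulVecInt_apply, cons_val]
  refine ⟨?_, ?_, ?_⟩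
  · ring
  · linear_combination (v 0 * (c * v 0 - a * v 1) - v 1 * (a * v 0 + b * v 1)) * hA
  · linear_combination (-(v 0 * (c * v 0 - a * v 1) - v 1 * (a * v 0 + b * v 1))) * hAB -
      (r * v 0 ^ 2 - (1 + 2 * p) * v 0 * v 1 - q * v 1 ^ 2) * hB
end

lemma exists_integer_eq {K : Type*} [Field K] {d : ℕ} {θ : K} (hθ : θ ^ 2 = -(d : K)) :
    ∃ t : 𝓞 K, (t : K) = θ := by
  have hI : IsIntegral ℤ θ := by
    refine IsIntegral.of_pow two_pos ?_
    rw [hθ, ← map_natCast (algebraMap ℤ K) d]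
    exact isIntegral_algebraMap.neg
  exact ⟨⟨θ, hI⟩, rfl⟩

/-- A dihedral pair of matrices over the integers of `ℚ(√-d)` makes `d` a rational norm from
`ℚ(√-3)`. -/
lemma exists_norm_of_entries {K : Type*} [Field K] [NumberField K] {d : ℕ} (hd : 0 < d) {θ : K}
    (hθ : θ ^ 2 = -(d : K)) (hrk : Module.finrank ℚ K = 2) {p q r a b c : 𝓞 K}
    (hA : p * (-1 - p) - q * r = 1) (hB : -a ^ 2 - b * c = 1)
    (hAB : p * a + q * c + r * b + (1 + p) * a = 0) :
    ∃ X Y Z : ℚ, Z ≠ 0 ∧ X ^ 2 + X * Y + Y ^ 2 = d * Z ^ 2 := by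
  let β : Module.Basis (Fin 2) ℤ (𝓞 K) :=
    Module.finBasisOfFinrankEq ℤ (𝓞 K) ((NumberField.RingOfIntegers.rank K).trans hrk)
  choose x y hxy using fun i => exists_eq_add_mul hd hθ hrk (β i : K)
  have hdQ : (0 : ℚ) < d := by exact_mod_cast hd
  have hrepr : ∀ z : 𝓞 K, (z : K) = ((β.repr z 0 * x 0 + β.repr z 1 * x 1 : ℚ) : K)
      + ((β.repr z 0 * y 0 + β.repr z 1 * y 1 : ℚ) : K) * θ := by
    intro z
    conv_lhs => rw [← β.sum_repr z]
    simp only [Fin.sum_univ_two, map_add, zsmul_eq_mul, map_mul, map_intCast, hxy]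
    push_cast
    ring
  set δ := x 0 * y 1 - x 1 * y 0 with hδ
  have hδ0 : δ ≠ 0 := by
    obtain ⟨t, ht⟩ := exists_integer_eq hθ
    have h1 := hrepr 1
    have h2 := hrepr t
    rw [ht] at h2
    have h3 := add_mul_inj hd hθ (x := 1) (y := 0) (by rw [← h1]; simp)
    have h4 := add_mul_inj hd hθ (x := 0) (y := 1) (by rw [← h2]; simp)
    intro h0
    have h5 : (1 : ℚ) = 0 := by
      obtain ⟨h31, h32⟩ := h3
      obtain ⟨h41, h42⟩ := h4
      set u := (β.repr 1 0 : ℚ)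
      set u' := (β.repr 1 1 : ℚ)
      set w := (β.repr t 0 : ℚ)
      set w' := (β.repr t 1 : ℚ)
      rw [hδ] at h0
      linear_combination h31 + (u * x 0 + u' * x 1) * h42 - (u * y 0 + u' * y 1) * h41
        + (u * w' - u' * w) * h0
    exact one_ne_zero h5
  obtain ⟨v, hv⟩ := (isQuatPair_mulVecInt hA hB hAB).exists_isUnit_det (pairCoord β)
  obtain ⟨h12, h13, h23⟩ := orbitPair_relations hA hB hAB v
  set A := mulVecInt !![p, q; r, -1 - p]
  set B := mulVecInt !![a, b; c, -a]
  set P := orbitMatrix (pairCoord β) A B v with hP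
  let W : Matrix (Fin 4) (Fin 4) ℚ :=
    !![x 0, y 0, 0, 0; x 1, y 1, 0, 0; 0, 0, x 0, y 0; 0, 0, x 1, y 1]
  have hW : W.det = δ ^ 2 := by
    simp [W, det_succ_row_zero, Fin.sum_univ_succ, Fin.succAbove]
    ring
  let T : Matrix (Fin 4) (Fin 4) ℚ := P.map (Int.castRingHom ℚ) * W
  have hT : T.det = P.det * δ ^ 2 := by
    rw [det_mul, hW, ← RingHom.mapMatrix_apply, ← RingHom.map_det]; rfl
  have hT0 : ∀ i, (orbitVec A B v i 0 : K) = T i 0 + T i 1 * θ := by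
    intro i
    rw [hrepr]
    simp [T, W, Matrix.mul_apply, Fin.sum_univ_succ, P, orbitMatrix, pairCoord]
  have hT1 : ∀ i, (orbitVec A B v i 1 : K) = T i 2 + T i 3 * θ := by
    intro i
    rw [hrepr]
    simp [T, W, Matrix.mul_apply, Fin.sum_univ_succ, P, orbitMatrix, pairCoord]
  have hM : ∀ i j, ((orbitPair A B v i j : 𝓞 K) : K) = rePair d T i j + imPair T i j * θ := by
    intro i j
    simp only [orbitPair, map_sub, map_mul, hT0, hT1, rePair, imPair]
    push_cast
    linear_combination ((T i 1 : K) * T j 3 - T i 3 * T j 1) * hθ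
  have e12 := congrArg (algebraMap (𝓞 K) K) h12
  have e13 := congrArg (algebraMap (𝓞 K) K) h13
  have e23 := congrArg (algebraMap (𝓞 K) K) h23
  simp only [map_sub, map_neg, hM] at e12 e13 e23
  obtain ⟨r12, i12⟩ := add_mul_inj hd hθ (x' := -rePair d T 0 2 - rePair d T 0 3)
    (y' := -imPair T 0 2 - imPair T 0 3) (e12.trans (by push_cast; ring))
  obtain ⟨r13, i13⟩ := add_mul_inj hd hθ e13
  obtain ⟨r23, i23⟩ := add_mul_inj hd hθ (x' := -rePair d T 0 1)
    (y' := -imPair T 0 1) (e23.trans (by push_cast; ring))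
  refine exists_norm_of_pairs hdQ hδ0 T ?_ r12 r13 r23 i12 i13 i23
  rw [hT]
  rcases Int.isUnit_iff.mp hv with h | h <;> simp [h]

/-- Satz Item33 (i).  Let `d ∈ ℕ` be squarefree and `k = ℚ(i√d)`
with ring of integers `𝔬`.  The Bianchi group `PSL₂(𝔬)` contains a subgroup isomorphic
to the dihedral group of order `6` (that is, to `S₃`) if and only if every prime
divisor `p ≠ 3` of `d` satisfies `p ≡ 1 (mod 3)`. -/
theorem stmt_19 (d : ℕ) (hd : Squarefree d) (hd1 : 1 ≤ d)
    (K : Type) [Field K] [NumberField K] (θ : K) (hθ : θ ^ 2 = -(d : K))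
    (hrk : Module.finrank ℚ K = 2) :
    (∃ H : Subgroup
        (Matrix.ProjectiveSpecialLinearGroup (Fin 2) (NumberField.RingOfIntegers K)),
      Nonempty (H ≃* DihedralGroup 3)) ↔
    ∀ p : ℕ, p.Prime → p ∣ d → p ≠ 3 → p % 3 = 1 := by
  constructor
  · rintro ⟨H, ⟨φ⟩⟩ p hp hpd hp3
    obtain ⟨p', q, r, a, b, c, hA, hB, hAB⟩ := exists_entries_of_dihedral H φ
    obtain ⟨X, Y, Z, hZ, h⟩ := exists_norm_of_entries hd1 hθ hrk hA hB hAB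
    exact prime_mod_three_of_norm hd hZ h hp hpd hp3
  · intro h
    obtain ⟨w, n, hn⟩ := exists_dvd_sq_add_add_one hd h
    obtain ⟨a, b, hab⟩ := exists_represents_one d n w hd1 hn.symm
    obtain ⟨t, htθ⟩ := exists_integer_eq hθ
    have ht : t ^ 2 = -((d : ℤ) : 𝓞 K) :=
      NumberField.RingOfIntegers.ext (by simpa [htθ] using hθ)
    have ht0 : t ≠ 0 := by
      rintro rfl
      have : (d : 𝓞 K) = 0 := by simpa using ht.symm
      have : d = 0 := by exact_mod_cast this
      omega
    have hn' : (w : 𝓞 K) ^ 2 + w + 1 = (d : ℤ) * n := by exact_mod_cast hn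
    have hab' : ((d : ℤ) : 𝓞 K) * a ^ 2 + (2 * w + 1) * a * b + n * b ^ 2 = 1 := by
      exact_mod_cast hab
    refine exists_dihedral_of_entries (p := (w : 𝓞 K)) (q := t) (r := n * t) (a := a * t)
      (b := b) (c := -(n * b + (2 * w + 1) * a)) ht0 ?_ ?_ ?_
    · linear_combination -hn' - n * ht
    · linear_combination hab' - (a : 𝓞 K) ^ 2 * ht
    · ring
end
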